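/- arXiv:1109.1381 — 2 statements merged into one kernel-verified Lean document; each statement's English description precedes it below -/
import Mathlib

section
/- Let ℓ ≥ 2. The S-module D(cS(D_ℓ)) is free of rank ℓ+1, and it admits a homogeneous basis consisting of one derivation of (polynomial) degree 1 and ℓ derivations of degree 2(ℓ−1); i.e. the cone over the Shi arrangement of type D_ℓ is a free arrangement with exponents (1, 2ℓ−2, …, 2ℓ−2), where 2ℓ−2 occurs ℓ times. -/
open MvPolynomial Finset

noncomputable section

/-- The polynomial ring `S = ℝ[x_1, …, x_ℓ, z]`; the variable indexed by
`Fin.castSucc i` is `x_{i+1}` and the variable indexed by `Fin.last ℓ` is `z`. -/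
abbrev SS (ℓ : ℕ) := MvPolynomial (Fin (ℓ + 1)) ℝ

/-- The defining linear forms of the cone over the Shi arrangement of type `D_ℓ`:
`x_s + εx_t − z` and `x_s + εx_t` for `1 ≤ s < t ≤ ℓ`, `ε ∈ {−1,1}`, together with `z`. -/
def forms (ℓ : ℕ) : Set (SS ℓ) :=
  {f | f = X (Fin.last ℓ) ∨
    ∃ (s t : Fin ℓ) (ε : ℝ), s < t ∧ (ε = 1 ∨ ε = -1) ∧
      (f = X s.castSucc + C ε * X t.castSucc - X (Fin.last ℓ) ∨
       f = X s.castSucc + C ε * X t.castSucc)}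

/-- A derivation of `S` is homogeneous of degree `d` if its value on each variable is
zero or a homogeneous polynomial of degree `d`. -/
def IsHomogeneousDer (ℓ : ℕ) (θ : Derivation ℝ (SS ℓ) (SS ℓ)) (d : ℕ) : Prop :=
  ∀ p : Fin (ℓ + 1), θ (X p) = 0 ∨ (θ (X p)).IsHomogeneous d

/-- The linear form with coefficient vector `c`. -/
def linForm {n : ℕ} (c : Fin n → ℝ) : MvPolynomial (Fin n) ℝ := ∑ k, c k • X k

lemma eval_linForm {n : ℕ} (c a : Fin n → ℝ) : eval a (linForm c) = ∑ k, c k * a k := by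
  simp [linForm, smul_eval]

lemma isHomogeneous_linForm {n : ℕ} (c : Fin n → ℝ) : (linForm c).IsHomogeneous 1 := by
  refine IsHomogeneous.sum _ _ _ fun k _ => ?_
  rw [smul_eq_C_mul]
  simpa using (isHomogeneous_C (Fin n) (c k)).mul (isHomogeneous_X ℝ k)

lemma derivation_linForm {n : ℕ} (c : Fin n → ℝ)
    (θ : Derivation ℝ (MvPolynomial (Fin n) ℝ) (MvPolynomial (Fin n) ℝ)) :
    θ (linForm c) = ∑ k, c k • θ (X k) := by
  simp [linForm]

/-- The projection of the polynomial ring along `X k` onto the hyperplane `linForm c = 0`. -/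
def hyperplaneProj {n : ℕ} (c : Fin n → ℝ) (k : Fin n) :
    MvPolynomial (Fin n) ℝ →ₐ[ℝ] MvPolynomial (Fin n) ℝ :=
  aeval fun i => X i - if i = k then (c k)⁻¹ • linForm c else 0

lemma hyperplaneProj_linForm {n : ℕ} {c : Fin n → ℝ} {k : Fin n} (hk : c k ≠ 0) :
    hyperplaneProj c k (linForm c) = 0 := by
  have h : hyperplaneProj c k (linForm c) =
      ∑ i, c i • (X i - if i = k then (c k)⁻¹ • linForm c else 0) := by
    simp [hyperplaneProj, linForm]
  rw [h]
  simp only [smul_sub, Finset.sum_sub_distrib, smul_ite, smul_zero, Finset.sum_ite_eq',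
    Finset.mem_univ, if_true, smul_smul, mul_inv_cancel₀ hk, one_smul]
  exact sub_self _

lemma linForm_dvd_iff_proj {n : ℕ} {c : Fin n → ℝ} {k : Fin n} (hk : c k ≠ 0)
    (F : MvPolynomial (Fin n) ℝ) : linForm c ∣ F ↔ hyperplaneProj c k F = 0 := by
  constructor
  · rintro ⟨G, rfl⟩
    rw [map_mul, hyperplaneProj_linForm hk, zero_mul]
  · intro h
    have key : (Ideal.Quotient.mkₐ ℝ (Ideal.span {linForm c})).comp (hyperplaneProj c k) =
        Ideal.Quotient.mkₐ ℝ (Ideal.span {linForm c}) := by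
      refine MvPolynomial.algHom_ext fun i => ?_
      simp only [AlgHom.comp_apply, hyperplaneProj, aeval_X]
      rw [Ideal.Quotient.mkₐ_eq_mk, Ideal.Quotient.eq, Ideal.mem_span_singleton]
      split_ifs
      · rw [sub_sub_cancel_left, smul_eq_C_mul]
        exact ((dvd_refl _).mul_left _).neg_right
      · simp
    have := DFunLike.congr_fun key F
    rw [AlgHom.comp_apply, h, map_zero, Ideal.Quotient.mkₐ_eq_mk] at this
    exact Ideal.mem_span_singleton.1 (Ideal.Quotient.eq_zero_iff_mem.1 this.symm)

lemma linForm_dvd_iff {n : ℕ} {c : Fin n → ℝ} (hc : ∃ k, c k ≠ 0)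
    (F : MvPolynomial (Fin n) ℝ) :
    linForm c ∣ F ↔ ∀ a : Fin n → ℝ, ∑ k, c k * a k = 0 → eval a F = 0 := by
  obtain ⟨k, hk⟩ := hc
  constructor
  · rintro ⟨G, rfl⟩ a ha
    rw [map_mul, eval_linForm, ha, zero_mul]
  · intro h
    rw [linForm_dvd_iff_proj hk]
    refine MvPolynomial.funext fun a => ?_
    have h1 : eval a (hyperplaneProj c k F) =
        eval (fun i => a i - if i = k then (c k)⁻¹ * ∑ j, c j * a j else 0) F := by
      rw [hyperplaneProj, aeval_def, eval₂_eq_eval_map, ← RingHom.comp_apply]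
      have : ((eval a).comp (eval (fun i => X i - if i = k then (c k)⁻¹ • linForm c else 0))).comp
          (map (algebraMap ℝ (MvPolynomial (Fin n) ℝ))) =
          eval (fun i => a i - if i = k then (c k)⁻¹ * ∑ j, c j * a j else 0) := by
        refine MvPolynomial.ringHom_ext (fun r => by simp) fun i => ?_
        by_cases hi : i = k
        · simp [hi, smul_eval, eval_linForm]
        · simp [hi]
      exact DFunLike.congr_fun this F
    rw [h1, map_zero]
    apply h
    simp only [mul_sub, Finset.sum_sub_distrib, mul_ite, mul_zero, Finset.sum_ite_eq',
      Finset.mem_univ, if_true]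
    rw [mul_inv_cancel_left₀ hk, sub_self]

lemma prime_linForm {n : ℕ} {c : Fin n → ℝ} (hc : ∃ k, c k ≠ 0) : Prime (linForm c) := by
  obtain ⟨k, hk⟩ := hc
  refine ⟨fun h0 => hk ?_, fun hu => ?_, fun F G h => ?_⟩
  · have := eval_linForm c (Pi.single k 1)
    rw [h0, map_zero] at this
    simpa [Pi.single_apply] using this.symm
  · have := hu.map (hyperplaneProj c k)
    rw [hyperplaneProj_linForm hk] at this
    exact not_isUnit_zero this
  · simp only [linForm_dvd_iff_proj hk, map_mul, mul_eq_zero] at h ⊢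
    exact h

/-- If `linForm c` divides a product with a polynomial `N` not vanishing identically on the
hyperplane, it divides the other factor; stated through real points. -/
lemma linForm_dvd_of_generic {n : ℕ} {c : Fin n → ℝ} (hc : ∃ k, c k ≠ 0)
    (F N : MvPolynomial (Fin n) ℝ) (a₀ : Fin n → ℝ) (ha₀ : ∑ k, c k * a₀ k = 0)
    (hN : eval a₀ N ≠ 0)
    (h : ∀ a : Fin n → ℝ, ∑ k, c k * a k = 0 → eval a N ≠ 0 → eval a F = 0) :
    linForm c ∣ F := by
  have h1 : linForm c ∣ N * F := by
    rw [linForm_dvd_iff hc]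
    intro a ha
    by_cases hNa : eval a N = 0
    · simp [hNa]
    · simp [h a ha hNa]
  refine ((prime_linForm hc).dvd_or_dvd h1).resolve_left fun h2 => hN ?_
  exact (linForm_dvd_iff hc N).1 h2 a₀ ha₀

lemma linForm_dvd_linForm {n : ℕ} {c c' : Fin n → ℝ} {j : Fin n} (hj : c j = 1)
    (h : linForm c ∣ linForm c') (k : Fin n) : c' k = c' j * c k := by
  have := (linForm_dvd_iff ⟨j, by simp [hj]⟩ _).1 h (Pi.single k 1 - c k • Pi.single j 1)
  simp only [eval_linForm, Pi.sub_apply, Pi.smul_apply, smul_eq_mul, mul_sub,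
    Finset.sum_sub_distrib, Pi.single_apply, mul_ite, mul_one, mul_zero, Finset.sum_ite_eq',
    Finset.mem_univ, if_true, hj, one_mul, sub_self] at this
  linarith [this trivial]

lemma linForm_dvd_det {n : ℕ} {c : Fin n → ℝ} (hc : ∃ k, c k ≠ 0)
    (A : Matrix (Fin n) (Fin n) (MvPolynomial (Fin n) ℝ))
    (hA : ∀ a, linForm c ∣ ∑ k, c k • A a k) : linForm c ∣ A.det := by
  obtain ⟨k, hk⟩ := hc
  let v : Fin n → MvPolynomial (Fin n) ℝ := fun k => C (c k)
  have h1 : A.adjugate.mulVec (A.mulVec v) = A.det • v := by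
    rw [Matrix.mulVec_mulVec, Matrix.adjugate_mul, Matrix.smul_mulVec, Matrix.one_mulVec]
  have h2 : linForm c ∣ A.det * C (c k) := by
    have := congrFun h1 k
    rw [Pi.smul_apply, smul_eq_mul] at this
    rw [← this]
    change linForm c ∣ ∑ a, A.adjugate k a * A.mulVec v a
    refine Finset.dvd_sum fun a _ => Dvd.dvd.mul_left ?_ _
    convert hA a using 1
    simp [Matrix.mulVec, dotProduct, v, smul_eq_C_mul, mul_comm]
  have hu : IsUnit (C (c k) : MvPolynomial (Fin n) ℝ) := (isUnit_iff_ne_zero.2 hk).map C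
  exact hu.dvd_mul_right.1 h2

/-- Saito's criterion. -/
theorem existsUnique_of_saito {n : ℕ} {I : Type*} [Fintype I] (c : I → Fin n → ℝ)
    (hc : ∀ i, ∃ k, c i k ≠ 0) (hrel : ∀ i j, i ≠ j → ¬ linForm (c i) ∣ linForm (c j))
    (θ : Fin n → Derivation ℝ (MvPolynomial (Fin n) ℝ) (MvPolynomial (Fin n) ℝ))
    (hθ : ∀ a i, linForm (c i) ∣ θ a (linForm (c i))) (d : Fin n → ℕ)
    (hd : ∀ a k, (θ a (X k)).IsHomogeneous (d a)) (hsum : ∑ a, d a = Fintype.card I)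
    (hdet : (Matrix.of fun a k => θ a (X k)).det ≠ 0)
    (η : Derivation ℝ (MvPolynomial (Fin n) ℝ) (MvPolynomial (Fin n) ℝ))
    (hη : ∀ i, linForm (c i) ∣ η (linForm (c i))) :
    ∃! f : Fin n → MvPolynomial (Fin n) ℝ, η = ∑ a, f a • θ a := by
  classical
  set A : Matrix (Fin n) (Fin n) (MvPolynomial (Fin n) ℝ) := Matrix.of fun a k => θ a (X k)
    with hA
  have hQ : ∀ F : MvPolynomial (Fin n) ℝ, (∀ i, linForm (c i) ∣ F) →
      ∏ i, linForm (c i) ∣ F := by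
    intro F hF
    refine Finset.prod_dvd_of_isRelPrime (fun i _ j _ hij => ?_) fun i _ => hF i
    exact (prime_linForm (hc i)).irreducible.isRelPrime_iff_not_dvd.2 (hrel i j hij)
  have hAd : ∀ a i, linForm (c i) ∣ ∑ k, c i k • A a k := fun a i => by
    simpa [hA, derivation_linForm] using hθ a i
  obtain ⟨K, hK⟩ := hQ A.det fun i => linForm_dvd_det (hc i) A fun a => hAd a i
  have hdeg : A.det.IsHomogeneous (Fintype.card I) := by
    rw [Matrix.det_apply, ← hsum]
    refine IsHomogeneous.sum _ _ _ fun σ _ => ?_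
    have : (∏ i, A (σ i) i).IsHomogeneous (∑ a, d a) := by
      rw [← Equiv.sum_comp σ d]
      exact IsHomogeneous.prod _ _ _ fun i _ => hd _ _
    rcases Int.units_eq_one_or (Equiv.Perm.sign σ) with h | h <;> rw [h]
    · simpa using this
    · simpa using this.neg
  have hQdeg : (∏ i, linForm (c i)).IsHomogeneous (Fintype.card I) := by
    have := IsHomogeneous.prod (Finset.univ : Finset I) (fun i => linForm (c i)) (fun _ => 1)
      fun i _ => isHomogeneous_linForm (c i)
    simpa using this
  have hK0 : K.totalDegree = 0 := by
    have hne := hdet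
    rw [hK] at hne
    have h1 := totalDegree_mul_of_isDomain (left_ne_zero_of_mul hne) (right_ne_zero_of_mul hne)
    rw [← hK, hdeg.totalDegree hdet, hQdeg.totalDegree (left_ne_zero_of_mul hne)] at h1
    omega
  have hKu : IsUnit K := by
    rw [totalDegree_eq_zero_iff_eq_C] at hK0
    rw [hK0]
    refine (isUnit_iff_ne_zero.2 fun h => hdet ?_).map C
    rw [hK, hK0, h, C_0, mul_zero]
  have hdd : ∀ F : MvPolynomial (Fin n) ℝ, (∀ i, linForm (c i) ∣ F) → A.det ∣ F := by
    intro F hF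
    rw [hK]
    exact (hKu.mul_right_dvd).2 (hQ F hF)
  let t : Fin n → MvPolynomial (Fin n) ℝ := fun k => η (X k)
  have hcr : ∀ a, A.det ∣ Matrix.vecMul t A.adjugate a := by
    intro a
    have h1 : Matrix.vecMul t A.adjugate a = (A.updateRow a t).det := by
      rw [← Matrix.det_transpose, ← Matrix.updateCol_transpose, ← Matrix.cramer_apply,
        Matrix.cramer_eq_adjugate_mulVec, ← Matrix.adjugate_transpose, Matrix.mulVec_transpose]
    rw [h1]
    refine hdd _ fun i => linForm_dvd_det (hc i) _ fun b => ?_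
    by_cases hb : b = a
    · subst hb
      simpa [t, derivation_linForm] using hη i
    · simpa [Matrix.updateRow_ne hb] using hAd b i
  choose f hf using hcr
  have hiff : ∀ g : Fin n → MvPolynomial (Fin n) ℝ, η = ∑ a, g a • θ a ↔ Matrix.vecMul g A = t := by
    intro g
    have hco : ∀ k, (∑ a, g a • θ a) (X k) = Matrix.vecMul g A k := fun k => by
      have := map_sum (Derivation.coeFnAddMonoidHom (R := ℝ) (A := MvPolynomial (Fin n) ℝ)
          (M := MvPolynomial (Fin n) ℝ)) (fun a => g a • θ a) univ
      simp only [Derivation.coeFnAddMonoidHom_apply] at this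
      rw [this, Finset.sum_apply]
      simp [Matrix.vecMul, dotProduct, hA]
    constructor
    · intro h
      funext k
      rw [← hco, ← h]
    · intro h
      refine MvPolynomial.derivation_ext fun k => ?_
      rw [hco, h]
  have hinj : ∀ v w : Fin n → MvPolynomial (Fin n) ℝ, Matrix.vecMul v A = Matrix.vecMul w A →
      v = w := by
    intro v w h
    refine sub_eq_zero.1 (Matrix.eq_zero_of_vecMul_eq_zero hdet ?_)
    rw [Matrix.sub_vecMul, h, sub_self]
  have hft : Matrix.vecMul f A = t := by
    have h1 : Matrix.vecMul t A.adjugate = A.det • f := funext fun a => by simp [hf a]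
    have h2 : A.det • Matrix.vecMul f A = A.det • t := by
      rw [← Matrix.smul_vecMul, ← h1, Matrix.vecMul_vecMul, Matrix.adjugate_mul,
        Matrix.vecMul_smul, Matrix.vecMul_one]
    funext k
    exact mul_left_cancel₀ hdet (congrFun h2 k)
  exact ⟨f, (hiff f).2 hft, fun g hg => hinj _ _ (((hiff g).1 hg).trans hft.symm)⟩

lemma exists_difference_eq (d : ℕ) : ∀ p : Polynomial ℝ, (∀ n, d ≤ n → p.coeff n = 0) →
    ∃ P : Polynomial ℝ, (∀ x, P.eval (x + 1) - P.eval x = p.eval x) ∧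
      (∀ n, d < n → P.coeff n = 0) ∧ d * P.coeff d = p.coeff (d - 1) := by
  induction d with
  | zero =>
    intro p hp
    have : p = 0 := Polynomial.ext fun n => by simpa using hp n (Nat.zero_le _)
    exact ⟨0, by simp [this]⟩
  | succ d ih =>
    intro p hp
    set P₀ : Polynomial ℝ := Polynomial.C (p.coeff d / (d + 1)) * Polynomial.X ^ (d + 1) with hP₀
    set E : Polynomial ℝ := Polynomial.C (p.coeff d / (d + 1)) *
      ((Polynomial.X + 1) ^ (d + 1) - Polynomial.X ^ (d + 1)) with hE
    obtain ⟨P, h1, h2, -⟩ := ih (p - E) (by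
      intro n hn
      rw [hE, Polynomial.coeff_sub, Polynomial.coeff_C_mul, Polynomial.coeff_sub,
        Polynomial.coeff_X_add_one_pow, Polynomial.coeff_X_pow]
      rcases hn.eq_or_lt with rfl | hn
      · have : ((d : ℝ) + 1) ≠ 0 := by positivity
        simp
        field_simp
        simp
      · rw [hp n hn]
        rcases Nat.eq_or_lt_of_le hn with rfl | hn
        · simp
        · rw [Nat.choose_eq_zero_of_lt hn, if_neg (by omega)]
          simp)
    refine ⟨P₀ + P, fun x => ?_, fun n hn => ?_, ?_⟩
    · have := h1 x
      simp only [hP₀, hE, Polynomial.eval_add, Polynomial.eval_mul, Polynomial.eval_C,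
        Polynomial.eval_pow, Polynomial.eval_X, Polynomial.eval_sub, Polynomial.eval_one] at this ⊢
      linear_combination this
    · rw [Polynomial.coeff_add, h2 n (by omega), hP₀, Polynomial.coeff_C_mul,
        Polynomial.coeff_X_pow, if_neg (by omega)]
      simp
    · rw [Polynomial.coeff_add, h2 (d + 1) (by omega), hP₀, Polynomial.coeff_C_mul,
        Polynomial.coeff_X_pow]
      have : ((d : ℝ) + 1) ≠ 0 := by positivity
      simp
      field_simp

lemma exists_odd_difference_eq (n : ℕ) : ∃ β : Polynomial ℝ,
    (∀ x, β.eval (x + 1) - β.eval x = (-(x * (x + 1))) ^ n) ∧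
    (∀ x, β.eval (-x) = -β.eval x) ∧ β.natDegree < 2 * n + 2 ∧ β.coeff (2 * n + 1) ≠ 0 := by
  have hdeg : (Polynomial.X * (Polynomial.X + 1) : Polynomial ℝ).natDegree = 2 := by
    compute_degree!
  have hmon : (Polynomial.X * (Polynomial.X + 1) : Polynomial ℝ).Monic := by
    exact Polynomial.monic_X.mul (Polynomial.monic_X_add_C 1)
  have hdegp : ((Polynomial.X * (Polynomial.X + 1) : Polynomial ℝ) ^ n).natDegree = 2 * n := by
    rw [hmon.natDegree_pow, hdeg, mul_comm]
  obtain ⟨P, h1, h2, h3⟩ := exists_difference_eq (2 * n + 1)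
    (Polynomial.C ((-1) ^ n) * (Polynomial.X * (Polynomial.X + 1)) ^ n) (by
      intro m hm
      rw [Polynomial.coeff_C_mul, Polynomial.coeff_eq_zero_of_natDegree_lt (by omega), mul_zero])
  have h4 : ((Polynomial.X * (Polynomial.X + 1) : Polynomial ℝ) ^ n).coeff (2 * n) = 1 := by
    rw [← hdegp]
    exact (hmon.pow n).coeff_natDegree
  have hcomp : ∀ m, (P.comp (-Polynomial.X)).coeff m = (-1) ^ m * P.coeff m := by
    intro m
    rw [← neg_one_mul, ← Polynomial.C_1, ← Polynomial.C_neg, Polynomial.comp_C_mul_X_coeff,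
      mul_comm]
  refine ⟨Polynomial.C (1 / 2) * (P - P.comp (-Polynomial.X)), fun x => ?_, fun x => ?_, ?_, ?_⟩
  · have ha := h1 x
    have hb := h1 (-x - 1)
    simp only [Polynomial.eval_mul, Polynomial.eval_C, Polynomial.eval_pow, Polynomial.eval_X,
      Polynomial.eval_add, Polynomial.eval_one, Polynomial.eval_sub, Polynomial.eval_comp,
      Polynomial.eval_neg, ← mul_pow] at ha hb ⊢
    rw [show -x - 1 + 1 = -x by ring, show (-1 : ℝ) * ((-x - 1) * -x) = -(x * (x + 1)) by ring]
      at hb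
    rw [show (-1 : ℝ) * (x * (x + 1)) = -(x * (x + 1)) by ring] at ha
    rw [show -(x + 1) = -x - 1 by ring]
    linear_combination (1 / 2) * ha + (1 / 2) * hb
  · simp
    ring
  · rw [Nat.lt_succ_iff, Polynomial.natDegree_le_iff_coeff_eq_zero]
    intro m hm
    rw [Polynomial.coeff_C_mul, Polynomial.coeff_sub, hcomp, h2 m hm]
    simp
  · rw [Polynomial.coeff_C_mul, Polynomial.coeff_sub, hcomp]
    intro h
    have h5 : P.coeff (2 * n + 1) = 0 := by
      rw [pow_succ, pow_mul] at h
      norm_num at h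
      linarith
    rw [h5, mul_zero, Nat.add_sub_cancel, Polynomial.coeff_C_mul, h4, mul_one] at h3
    exact pow_ne_zero n (by norm_num) h3.symm

/-- An odd polynomial with `β (x + 1) - β x = (-x (x + 1)) ^ n`. -/
def oddBern (n : ℕ) : Polynomial ℝ := (exists_odd_difference_eq n).choose

lemma oddBern_spec (n : ℕ) :
    (∀ x, (oddBern n).eval (x + 1) - (oddBern n).eval x = (-(x * (x + 1))) ^ n) ∧
    (∀ x, (oddBern n).eval (-x) = -(oddBern n).eval x) ∧ (oddBern n).natDegree < 2 * n + 2 ∧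
    (oddBern n).coeff (2 * n + 1) ≠ 0 :=
  (exists_odd_difference_eq n).choose_spec

/-- The homogenization of `oddBern n` in degree `2 * n + 1`. -/
def homBern {A : Type*} [CommRing A] [Algebra ℝ A] (n : ℕ) (x z : A) : A :=
  ∑ k ∈ range (2 * n + 2), (oddBern n).coeff k • (x ^ k * z ^ (2 * n + 1 - k))

lemma map_homBern {A B : Type*} [CommRing A] [Algebra ℝ A] [CommRing B] [Algebra ℝ B]
    (φ : A →ₐ[ℝ] B) (n : ℕ) (x z : A) : φ (homBern n x z) = homBern n (φ x) (φ z) := by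
  simp [homBern]

lemma isHomogeneous_homBern {σ : Type*} (n : ℕ) (x z : MvPolynomial σ ℝ)
    (hx : x.IsHomogeneous 1) (hz : z.IsHomogeneous 1) :
    (homBern n x z).IsHomogeneous (2 * n + 1) := by
  refine IsHomogeneous.sum _ _ _ fun k hk => ?_
  rw [smul_eq_C_mul]
  have h := (isHomogeneous_C σ ((oddBern n).coeff k)).mul
    ((hx.pow k).mul (hz.pow (2 * n + 1 - k)))
  rw [mem_range] at hk
  rwa [show 0 + (1 * k + 1 * (2 * n + 1 - k)) = 2 * n + 1 by omega] at h

lemma homBern_eq {n : ℕ} {x z : ℝ} (hz : z ≠ 0) :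
    homBern n x z = z ^ (2 * n + 1) * (oddBern n).eval (x / z) := by
  rw [Polynomial.eval_eq_sum_range' (oddBern_spec n).2.2.1, homBern, mul_sum]
  refine sum_congr rfl fun k hk => ?_
  rw [mem_range] at hk
  rw [smul_eq_mul, div_pow]
  have : z ^ (2 * n + 1) = z ^ k * z ^ (2 * n + 1 - k) := by
    rw [← pow_add]; congr 1; omega
  rw [this]
  field_simp

lemma homBern_add_sub {n : ℕ} {x z : ℝ} (hz : z ≠ 0) :
    homBern n (x + z) z - homBern n x z = z * (-(x * (x + z))) ^ n := by
  rw [homBern_eq hz, homBern_eq hz, ← mul_sub, add_div, div_self hz, (oddBern_spec n).1,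
    pow_succ, pow_mul, mul_right_comm, ← mul_pow, mul_comm]
  congr 2
  field_simp

lemma homBern_neg {n : ℕ} {x z : ℝ} (hz : z ≠ 0) :
    homBern n (-x) z = -homBern n x z := by
  rw [homBern_eq hz, homBern_eq hz, neg_div, (oddBern_spec n).2.1, mul_neg]

lemma homBern_zero_right (n : ℕ) (x : ℝ) :
    homBern n x 0 = (oddBern n).coeff (2 * n + 1) * x ^ (2 * n + 1) := by
  rw [homBern, sum_eq_single (2 * n + 1)]
  · simp
  · intro k hk hne
    rw [mem_range] at hk
    rw [zero_pow (by omega), mul_zero, smul_zero]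
  · simp

/-- `G` is homogeneous of degree `d` when the polynomial variable is given weight `w`. -/
def IsWeightedHom {σ : Type*} (w d : ℕ) (G : Polynomial (MvPolynomial σ ℝ)) : Prop :=
  ∀ n, G.coeff n = 0 ∨ ∃ m, m + w * n = d ∧ (G.coeff n).IsHomogeneous m

namespace IsWeightedHom

variable {σ : Type*} {w d e : ℕ} {F G : Polynomial (MvPolynomial σ ℝ)}

lemma sum_aux {ι : Type*} {s : Finset ι} {f : ι → MvPolynomial σ ℝ} {n : ℕ}
    (h : ∀ i ∈ s, f i = 0 ∨ ∃ m, m + n = d ∧ (f i).IsHomogeneous m) :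
    ∑ i ∈ s, f i = 0 ∨ ∃ m, m + n = d ∧ (∑ i ∈ s, f i).IsHomogeneous m := by
  by_cases hn : n ≤ d
  · refine Or.inr ⟨d - n, by omega, IsHomogeneous.sum _ _ _ fun i hi => ?_⟩
    rcases h i hi with h0 | ⟨m, hm, hh⟩
    · rw [h0]; exact isHomogeneous_zero _ _ _
    · rwa [show d - n = m by omega]
  · refine Or.inl (sum_eq_zero fun i hi => ?_)
    rcases h i hi with h0 | ⟨m, hm, -⟩
    · exact h0
    · omega

lemma sum {ι : Type*} {s : Finset ι} {f : ι → Polynomial (MvPolynomial σ ℝ)}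
    (h : ∀ i ∈ s, IsWeightedHom w d (f i)) : IsWeightedHom w d (∑ i ∈ s, f i) := by
  intro n
  rw [Polynomial.finsetSum_coeff]
  exact sum_aux fun i hi => h i hi n

lemma neg (hF : IsWeightedHom w d F) : IsWeightedHom w d (-F) := by
  intro n
  rw [Polynomial.coeff_neg]
  rcases hF n with h | ⟨m, hm, h⟩
  · exact Or.inl (by simp [h])
  · exact Or.inr ⟨m, hm, h.neg⟩

lemma add (hF : IsWeightedHom w d F) (hG : IsWeightedHom w d G) : IsWeightedHom w d (F + G) := by
  have := sum (s := (Finset.univ : Finset Bool)) (f := fun b => cond b F G) (w := w) (d := d)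
    (by rintro (_ | _) _ <;> assumption)
  simpa using this

lemma sub (hF : IsWeightedHom w d F) (hG : IsWeightedHom w d G) : IsWeightedHom w d (F - G) := by
  rw [sub_eq_add_neg]
  exact hF.add hG.neg

lemma mul (hF : IsWeightedHom w d F) (hG : IsWeightedHom w e G) :
    IsWeightedHom w (d + e) (F * G) := by
  intro n
  rw [Polynomial.coeff_mul]
  refine sum_aux fun ij hij => ?_
  rw [HasAntidiagonal.mem_antidiagonal] at hij
  rcases hF ij.1 with h0 | ⟨m, hm, h⟩
  · exact Or.inl (by simp [h0])
  rcases hG ij.2 with h0 | ⟨m', hm', h'⟩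
  · exact Or.inl (by simp [h0])
  refine Or.inr ⟨m + m', ?_, h.mul h'⟩
  rw [← hij, mul_add]
  omega

lemma const {a : MvPolynomial σ ℝ} (ha : a.IsHomogeneous d) :
    IsWeightedHom w d (Polynomial.C a) := by
  intro n
  rw [Polynomial.coeff_C]
  split_ifs with h
  · exact Or.inr ⟨d, by simp [h], ha⟩
  · exact Or.inl rfl

lemma X : IsWeightedHom w w (Polynomial.X : Polynomial (MvPolynomial σ ℝ)) := by
  intro n
  rw [Polynomial.coeff_X]
  split_ifs with h
  · exact Or.inr ⟨0, by simp [← h], isHomogeneous_one _ _⟩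
  · exact Or.inl rfl

lemma prod {ι : Type*} {s : Finset ι} {f : ι → Polynomial (MvPolynomial σ ℝ)}
    (h : ∀ i ∈ s, IsWeightedHom w d (f i)) : IsWeightedHom w (#s * d) (∏ i ∈ s, f i) := by
  classical
  induction s using Finset.induction_on with
  | empty =>
    rw [prod_empty, ← Polynomial.C_1]
    simpa using const (w := w) (isHomogeneous_one σ ℝ)
  | insert i s hi ih =>
    rw [prod_insert hi, card_insert_of_notMem hi, add_mul, one_mul, add_comm]
    exact (h i (mem_insert_self _ _)).mul (ih fun j hj => h j (mem_insert_of_mem hj))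

lemma const_mul_divX {a : MvPolynomial σ ℝ} (ha : a.IsHomogeneous d) (hwd : w ≤ d)
    (hG : IsWeightedHom w e G) :
    IsWeightedHom w (d + e - w) (Polynomial.C a * G.divX) := by
  intro n
  rw [Polynomial.coeff_C_mul, Polynomial.coeff_divX]
  rcases hG (n + 1) with h0 | ⟨m, hm, h⟩
  · exact Or.inl (by simp [h0])
  · refine Or.inr ⟨d + m, ?_, ha.mul h⟩
    rw [mul_add, mul_one] at hm
    omega

lemma coeff_eq_zero (hG : IsWeightedHom w d G) {n : ℕ} (hn : d < w * n) : G.coeff n = 0 := by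
  rcases hG n with h0 | ⟨m, hm, h⟩
  · exact h0
  · omega

lemma isHomogeneous_coeff (hG : IsWeightedHom w d G) {n m : ℕ} (h : m + w * n = d) :
    (G.coeff n).IsHomogeneous m := by
  rcases hG n with h0 | ⟨m', hm, h'⟩
  · rw [h0]; exact isHomogeneous_zero _ _ _
  · rwa [show m = m' by omega]

end IsWeightedHom

/-- The complete homogeneous symmetric polynomials in `u, v`, written in terms of `z = u + v`
and the polynomial variable `u * v`. -/
def completeSymm {A : Type*} [CommRing A] (z : A) : ℕ → Polynomial A
  | 0 => 1
  | 1 => Polynomial.C z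
  | n + 2 => Polynomial.C z * completeSymm z (n + 1) - Polynomial.X * completeSymm z n

lemma sub_mul_eval_completeSymm {A B : Type*} [CommRing A] [CommRing B] (φ : A →+* B) {z : A}
    {u v : B} (hz : φ z = u + v) (n : ℕ) :
    (u - v) * (completeSymm z n).eval₂ φ (u * v) = u ^ (n + 1) - v ^ (n + 1) := by
  induction n using Nat.strong_induction_on with
  | _ n ih =>
    match n with
    | 0 => simp [completeSymm]
    | 1 => simp [completeSymm, hz]; ring
    | n + 2 =>
      have h1 := ih (n + 1) (by omega)
      have h0 := ih n (by omega)
      simp only [completeSymm, Polynomial.eval₂_sub, Polynomial.eval₂_mul, Polynomial.eval₂_C,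
        Polynomial.eval₂_X, hz]
      linear_combination (u + v) * h1 - u * v * h0

lemma isWeightedHom_completeSymm {σ : Type*} {z : MvPolynomial σ ℝ} (hz : z.IsHomogeneous 1)
    (n : ℕ) : IsWeightedHom 2 n (completeSymm z n) := by
  induction n using Nat.strong_induction_on with
  | _ n ih =>
    match n with
    | 0 =>
      rw [completeSymm, ← Polynomial.C_1]
      exact IsWeightedHom.const (isHomogeneous_one _ _)
    | 1 => exact IsWeightedHom.const hz
    | n + 2 =>
      have h1 := (IsWeightedHom.const (w := 2) hz).mul (ih (n + 1) (by omega))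
      have h0 := IsWeightedHom.X.mul (ih n (by omega))
      rw [show 1 + (n + 1) = n + 2 by omega] at h1
      rw [show 2 + n = n + 2 by omega] at h0
      exact h1.sub h0

/-- For `R = ∑ r_m u ^ m`, the symmetric polynomial `∑ r_{m+2} (u ^ (m+1) - v ^ (m+1)) / (u - v)`
written in terms of `z = u + v` and the polynomial variable `u * v`. -/
def dividedDiff {A : Type*} [CommRing A] (z : A) (R : Polynomial A) : Polynomial A :=
  ∑ m ∈ range (R.natDegree + 1), Polynomial.C (R.coeff (m + 2)) * completeSymm z m

lemma sub_mul_eval_dividedDiff {A B : Type*} [CommRing A] [Field B] (φ : A →+* B) {z : A}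
    {u v : B} (hz : φ z = u + v) (hu : u ≠ 0) (hv : v ≠ 0) (R : Polynomial A) :
    (u - v) * (dividedDiff z R).eval₂ φ (u * v) =
      R.eval₂ φ u / u - R.eval₂ φ v / v - φ (R.coeff 0) * (1 / u - 1 / v) := by
  have hR : ∀ t : B, t ≠ 0 → R.eval₂ φ t / t = φ (R.coeff 0) / t + φ (R.coeff 1) +
      ∑ m ∈ range (R.natDegree + 1), φ (R.coeff (m + 2)) * t ^ (m + 1) := by
    intro t ht
    rw [Polynomial.eval₂_eq_sum_range' φ (show R.natDegree < R.natDegree + 3 by omega),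
      sum_range_succ', sum_range_succ', add_div, add_div, sum_div]
    simp only [pow_zero, mul_one, zero_add, pow_one, mul_div_cancel_right₀ _ ht]
    have : ∀ m, φ (R.coeff (m + 1 + 1)) * t ^ (m + 1 + 1) / t =
        φ (R.coeff (m + 2)) * t ^ (m + 1) := fun m => by
      rw [pow_succ t (m + 1), ← mul_assoc, mul_div_cancel_right₀ _ ht]
    simp only [this]
    ring
  rw [hR u hu, hR v hv, dividedDiff, Polynomial.eval₂_finsetSum, mul_sum]
  simp only [Polynomial.eval₂_mul, Polynomial.eval₂_C]
  have : ∀ m, (u - v) * (φ (R.coeff (m + 2)) * (completeSymm z m).eval₂ φ (u * v)) =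
      φ (R.coeff (m + 2)) * u ^ (m + 1) - φ (R.coeff (m + 2)) * v ^ (m + 1) := fun m => by
    rw [mul_left_comm, sub_mul_eval_completeSymm φ hz]
    ring
  simp only [this, sum_sub_distrib]
  ring

lemma isWeightedHom_dividedDiff {σ : Type*} {z : MvPolynomial σ ℝ} (hz : z.IsHomogeneous 1)
    {R : Polynomial (MvPolynomial σ ℝ)} {d : ℕ} (hR : IsWeightedHom 1 (d + 2) R) :
    IsWeightedHom 2 d (dividedDiff z R) := by
  refine IsWeightedHom.sum fun m _ => ?_
  by_cases hm : m ≤ d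
  · have h := (IsWeightedHom.const (w := 2)
      (hR.isHomogeneous_coeff (n := m + 2) (m := d - m) (by omega))).mul
      (isWeightedHom_completeSymm hz m)
    rwa [show d - m + m = d by omega] at h
  · rw [hR.coeff_eq_zero (by omega)]
    intro n
    simp

/-- The polynomial in `u * v` (with `u + v = z`) which equals
`c * M (u * v) * (R u / u - R v / v) / (u - v)` up to a pole at `u * v = 0`. -/
def shiDelta {A : Type*} [CommRing A] (z c : A) (R M : Polynomial A) : Polynomial A :=
  Polynomial.C c * (M * dividedDiff z R - Polynomial.C (R.coeff 0) * M.divX)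

lemma eval_shiDelta {A B : Type*} [CommRing A] [Field B] (φ : A →+* B) {z : A}
    {u v : B} (hz : φ z = u + v) (hu : u ≠ 0) (hv : v ≠ 0) (c : A) (R M : Polynomial A) :
    (u - v) * ((shiDelta z c R M).eval₂ φ (u * v) - φ (c * R.coeff 0 * M.coeff 0) / (u * v)) =
      φ c * M.eval₂ φ (u * v) * (R.eval₂ φ u / u - R.eval₂ φ v / v) := by
  have hM : M.eval₂ φ (u * v) = M.divX.eval₂ φ (u * v) * (u * v) + φ (M.coeff 0) := by
    conv_lhs => rw [← Polynomial.divX_mul_X_add M]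
    simp
  have hK := sub_mul_eval_dividedDiff φ hz hu hv R
  have h1 : (1 / u - 1 / v) = -(u - v) / (u * v) := by
    field_simp
    ring
  rw [h1] at hK
  simp only [shiDelta, Polynomial.eval₂_sub, Polynomial.eval₂_mul, Polynomial.eval₂_C, map_mul]
  have h2 : R.eval₂ φ u / u - R.eval₂ φ v / v = (u - v) * (dividedDiff z R).eval₂ φ (u * v) +
      φ (R.coeff 0) * (-(u - v) / (u * v)) := by linear_combination -hK
  rw [h2, hM]
  field_simp
  ring

lemma isWeightedHom_shiDelta {σ : Type*} {z c : MvPolynomial σ ℝ} (hz : z.IsHomogeneous 1)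
    (hc : c.IsHomogeneous 1) {R M : Polynomial (MvPolynomial σ ℝ)} {r m : ℕ}
    (hR : IsWeightedHom 1 (r + 2) R) (hM : IsWeightedHom 2 m M) :
    IsWeightedHom 2 (r + m + 1) (shiDelta z c R M) := by
  have h0 : (R.coeff 0).IsHomogeneous (r + 2) := hR.isHomogeneous_coeff (by omega)
  have h1 := hM.mul (isWeightedHom_dividedDiff hz hR)
  have h2 := IsWeightedHom.const_mul_divX (w := 2) h0 (by omega) hM
  rw [show r + 2 + m - 2 = m + r by omega] at h2
  have h3 := (IsWeightedHom.const (w := 2) hc).mul (h1.sub h2)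
  rwa [show 1 + (m + r) = r + m + 1 by omega] at h3

section ShiD

variable {ℓ : ℕ}

/-- The value at `x` of the odd function with `f u + f v = z * (∑ δ n * (u * v) ^ n - κ / (u * v))`
for `u + v = z`. -/
def oddSum (ℓ : ℕ) (δ : ℕ → ℝ) (κ z x : ℝ) : ℝ :=
  ∑ n ∈ range ℓ, δ n * homBern n x z - κ / x

lemma oddSum_neg {δ : ℕ → ℝ} {κ z : ℝ} (hz : z ≠ 0) (x : ℝ) :
    oddSum ℓ δ κ z (-x) = -oddSum ℓ δ κ z x := by
  simp only [oddSum, homBern_neg hz, mul_neg, sum_neg_distrib, div_neg]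
  ring

lemma oddSum_add {δ : ℕ → ℝ} {κ z u v : ℝ} (hz : z ≠ 0) (huv : u + v = z) (hu : u ≠ 0)
    (hv : v ≠ 0) : oddSum ℓ δ κ z u + oddSum ℓ δ κ z v =
      z * (∑ n ∈ range ℓ, δ n * (u * v) ^ n - κ / (u * v)) := by
  have h : ∀ n, homBern n u z + homBern n v z = z * (u * v) ^ n := fun n => by
    have h1 := homBern_add_sub (n := n) (x := -v) hz
    rw [homBern_neg hz, show -v + z = u by linarith] at h1
    rw [show -(-v * u) = u * v by ring] at h1
    linarith
  have h2 : ∑ n ∈ range ℓ, δ n * homBern n u z + ∑ n ∈ range ℓ, δ n * homBern n v z =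
      z * ∑ n ∈ range ℓ, δ n * (u * v) ^ n := by
    rw [← sum_add_distrib, mul_sum]
    refine sum_congr rfl fun n _ => ?_
    rw [← mul_add, h]
    ring
  have h3 : κ / u + κ / v = z * (κ / (u * v)) := by
    rw [← huv]
    field_simp
    ring
  simp only [oddSum]
  linear_combination h2 - h3

/-- The `i`-th coefficient of the derivation attached to `Δ`, with pole part `κ`. -/
def shiValue (Δ : Polynomial (SS ℓ)) (κ : SS ℓ) (i : Fin ℓ) : SS ℓ :=
  ∑ n ∈ range ℓ, Δ.coeff n * homBern n (X i.castSucc) (X (Fin.last ℓ)) -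
    κ * ∏ k ∈ univ.erase i, X k.castSucc

lemma eval_shiValue (Δ : Polynomial (SS ℓ)) (κ : SS ℓ) {i : Fin ℓ} {a : Fin (ℓ + 1) → ℝ}
    (ha : a i.castSucc ≠ 0) : eval a (shiValue Δ κ i) =
      oddSum ℓ (fun n => eval a (Δ.coeff n)) (eval a κ * ∏ k : Fin ℓ, a k.castSucc)
        (a (Fin.last ℓ)) (a i.castSucc) := by
  have h : ∀ n, eval a (homBern n (X i.castSucc) (X (Fin.last ℓ)) : SS ℓ) =
      homBern n (a i.castSucc) (a (Fin.last ℓ)) := fun n => by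
    have := map_homBern (aeval a : SS ℓ →ₐ[ℝ] ℝ) n (X i.castSucc) (X (Fin.last ℓ))
    simpa [aeval_eq_eval] using this
  rw [shiValue, oddSum, ← mul_prod_erase univ _ (mem_univ i)]
  simp only [map_sub, map_sum, map_mul, map_prod, eval_X, h]
  field_simp

lemma isHomogeneous_shiValue {Δ : Polynomial (SS ℓ)} {κ : SS ℓ} {d : ℕ}
    (hΔ : IsWeightedHom 2 d Δ) (hκ : κ.IsHomogeneous (d + 2 - ℓ)) (hd : ℓ ≤ d + 2) (i : Fin ℓ) :
    (shiValue Δ κ i).IsHomogeneous (d + 1) := by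
  refine IsHomogeneous.sub (IsHomogeneous.sum _ _ _ fun n _ => ?_) ?_
  · rcases hΔ n with h | ⟨m, hm, h⟩
    · rw [h, zero_mul]
      exact isHomogeneous_zero _ _ _
    · have := h.mul (isHomogeneous_homBern n _ _ (isHomogeneous_X ℝ i.castSucc)
        (isHomogeneous_X ℝ (Fin.last ℓ)))
      rwa [show m + (2 * n + 1) = d + 1 by omega] at this
  · have h := IsHomogeneous.prod (univ.erase i) (fun k : Fin ℓ => (X k.castSucc : SS ℓ))
      (fun _ => 1) fun k _ => isHomogeneous_X ℝ _
    have hi := i.2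
    have hc : #(univ.erase i) = ℓ - 1 := by simp
    rw [sum_const, hc, smul_eq_mul, mul_one] at h
    have := hκ.mul h
    rwa [show d + 2 - ℓ + (ℓ - 1) = d + 1 by omega] at this

/-- The polynomial `(u - x_p) (u + ε x_q) ∏_{k > q} (u ^ 2 - x_k ^ 2)`. -/
def shiR (p q : Fin ℓ) (ε : ℝ) : Polynomial (SS ℓ) :=
  (Polynomial.X - Polynomial.C (X p.castSucc)) *
    (Polynomial.X + Polynomial.C (C ε * X q.castSucc)) *
    ∏ k ∈ Ioi q, (Polynomial.X - Polynomial.C (X k.castSucc)) *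
      (Polynomial.X + Polynomial.C (X k.castSucc))

/-- The polynomial `∏_{k < p} (u - x_k) (v - x_k)` in `u * v`, where `u + v = z`. -/
def shiM (p : Fin ℓ) : Polynomial (SS ℓ) :=
  ∏ k ∈ Iio p, (Polynomial.X + Polynomial.C (X k.castSucc * (X k.castSucc - X (Fin.last ℓ))))

/-- The shifted simple root `x_p + ε x_q - z`. -/
def shiRoot (p q : Fin ℓ) (ε : ℝ) : SS ℓ :=
  X p.castSucc + C ε * X q.castSucc - X (Fin.last ℓ)

/-- The quotient of the product of the constant terms of `shiR` and `shiM` by `∏ k, x_k`. -/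
def shiRho (p q : Fin ℓ) (ε : ℝ) : SS ℓ :=
  -(C ε * ∏ k ∈ Ioi q, -X k.castSucc) * ∏ k ∈ Iio p, (X k.castSucc - X (Fin.last ℓ))

/-- The coefficients of the basis derivation attached to the simple root `x_p + ε x_q`. -/
def shiCoeff (p q : Fin ℓ) (ε : ℝ) (i : Fin ℓ) : SS ℓ :=
  shiValue (shiDelta (X (Fin.last ℓ)) (shiRoot p q ε) (shiR p q ε) (shiM p))
    (shiRoot p q ε * shiRho p q ε) i

lemma isHomogeneous_shiRoot (p q : Fin ℓ) (ε : ℝ) : (shiRoot p q ε).IsHomogeneous 1 :=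
  ((isHomogeneous_X ℝ _).add (isHomogeneous_C_mul_X ε _)).sub (isHomogeneous_X ℝ _)

lemma isWeightedHom_shiR (p q : Fin ℓ) (ε : ℝ) :
    IsWeightedHom 1 ((ℓ - 1 - q) * 2 + 2) (shiR p q ε) := by
  have h1 := (IsWeightedHom.X.sub (IsWeightedHom.const (isHomogeneous_X ℝ p.castSucc))).mul
    (IsWeightedHom.X.add (IsWeightedHom.const (isHomogeneous_C_mul_X ε q.castSucc)))
  have h2 : IsWeightedHom 1 (#(Ioi q) * 2) (∏ k ∈ Ioi q,
      (Polynomial.X - Polynomial.C (X k.castSucc : SS ℓ)) *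
      (Polynomial.X + Polynomial.C (X k.castSucc))) :=
    IsWeightedHom.prod fun k _ =>
      (IsWeightedHom.X.sub (IsWeightedHom.const (isHomogeneous_X ℝ k.castSucc))).mul
        (IsWeightedHom.X.add (IsWeightedHom.const (isHomogeneous_X ℝ k.castSucc)))
  rw [Fin.card_Ioi] at h2
  have h3 := h1.mul h2
  rwa [show 1 + 1 + (ℓ - 1 - (q : ℕ)) * 2 = (ℓ - 1 - q) * 2 + 2 by omega] at h3

lemma isWeightedHom_shiM (p : Fin ℓ) : IsWeightedHom 2 (p * 2) (shiM p) := by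
  have h : IsWeightedHom 2 (#(Iio p) * 2) (shiM p) := IsWeightedHom.prod fun k _ =>
    IsWeightedHom.X.add (IsWeightedHom.const
      ((isHomogeneous_X ℝ k.castSucc).mul
        ((isHomogeneous_X ℝ k.castSucc).sub (isHomogeneous_X ℝ (Fin.last ℓ)))))
  rwa [Fin.card_Iio] at h

lemma isHomogeneous_shiRho (p q : Fin ℓ) (ε : ℝ) :
    (shiRho p q ε).IsHomogeneous (ℓ - 1 - q + p) := by
  have h1 := IsHomogeneous.prod (Ioi q) (fun k : Fin ℓ => (-X k.castSucc : SS ℓ))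
      (fun _ => 1) fun k _ => (isHomogeneous_X ℝ _).neg
  have h2 := IsHomogeneous.prod (Iio p) (fun k : Fin ℓ => (X k.castSucc - X (Fin.last ℓ) : SS ℓ))
      (fun _ => 1) fun k _ => (isHomogeneous_X ℝ _).sub (isHomogeneous_X ℝ _)
  rw [sum_const, Fin.card_Ioi, smul_eq_mul, mul_one] at h1
  rw [sum_const, Fin.card_Iio, smul_eq_mul, mul_one] at h2
  have h := ((isHomogeneous_C (Fin (ℓ + 1)) ε).mul h1).neg.mul h2
  rwa [zero_add] at h

variable {p q : Fin ℓ} {ε : ℝ}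

lemma isWeightedHom_delta (hq : (q : ℕ) = p + 1) : IsWeightedHom 2 (2 * ℓ - 3)
    (shiDelta (X (Fin.last ℓ)) (shiRoot p q ε) (shiR p q ε) (shiM p)) := by
  have h := isWeightedHom_shiDelta (isHomogeneous_X ℝ (Fin.last ℓ)) (isHomogeneous_shiRoot p q ε)
    (isWeightedHom_shiR p q ε) (isWeightedHom_shiM p)
  have := q.2
  rwa [show (ℓ - 1 - (q : ℕ)) * 2 + p * 2 + 1 = 2 * ℓ - 3 by omega] at h

lemma isHomogeneous_shiCoeff (hq : (q : ℕ) = p + 1) (i : Fin ℓ) :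
    (shiCoeff p q ε i).IsHomogeneous (2 * (ℓ - 1)) := by
  have := q.2
  have h1 := (isHomogeneous_shiRoot p q ε).mul (isHomogeneous_shiRho p q ε)
  rw [show 1 + (ℓ - 1 - (q : ℕ) + p) = 2 * ℓ - 3 + 2 - ℓ by omega] at h1
  have h := isHomogeneous_shiValue (isWeightedHom_delta (ε := ε) hq) h1 (by omega) i
  rwa [show 2 * ℓ - 3 + 1 = 2 * (ℓ - 1) by omega] at h

lemma prod_eq_mul_Ioi (hq : (q : ℕ) = p + 1) {A : Type*} [CommRing A] (f : Fin ℓ → A) :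
    ∏ k, f k = (∏ k ∈ Iio p, f k) * f p * f q * ∏ k ∈ Ioi q, f k := by
  have hu : (univ : Finset (Fin ℓ)) = insert p (insert q (Iio p ∪ Ioi q)) := by
    ext k
    simp only [mem_univ, mem_insert, mem_union, mem_Iio, mem_Ioi, Fin.lt_def, Fin.ext_iff, true_iff]
    omega
  have hd : Disjoint (Iio p) (Ioi q) := by
    rw [Finset.disjoint_left]
    intro k hk hk'
    simp only [mem_Iio, mem_Ioi, Fin.lt_def] at hk hk'
    omega
  rw [hu, prod_insert, prod_insert, prod_union hd]
  · ring
  · simp only [mem_union, mem_Iio, mem_Ioi, Fin.lt_def]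
    omega
  · simp only [mem_insert, mem_union, mem_Iio, mem_Ioi, Fin.lt_def, Fin.ext_iff]
    omega

lemma shiRoot_mul_coeff_zero (hq : (q : ℕ) = p + 1) :
    shiRoot p q ε * (shiR p q ε).coeff 0 * (shiM p).coeff 0 =
      shiRoot p q ε * shiRho p q ε * ∏ k : Fin ℓ, X k.castSucc := by
  rw [prod_eq_mul_Ioi hq, Polynomial.coeff_zero_eq_eval_zero, Polynomial.coeff_zero_eq_eval_zero]
  simp only [shiR, shiM, shiRho, Polynomial.eval_mul, Polynomial.eval_prod, Polynomial.eval_add,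
    Polynomial.eval_sub, Polynomial.eval_X, Polynomial.eval_C, zero_add, zero_sub, prod_mul_distrib]
  ring

lemma eval_shiR (a : Fin (ℓ + 1) → ℝ) (u : ℝ) : (shiR p q ε).eval₂ (eval a) u =
    (u - a p.castSucc) * (u + ε * a q.castSucc) *
      ∏ k ∈ Ioi q, (u - a k.castSucc) * (u + a k.castSucc) := by
  simp [shiR, Polynomial.eval₂_mul, Polynomial.eval₂_finsetProd]

lemma eval_shiM (a : Fin (ℓ + 1) → ℝ) {u v : ℝ} (huv : u + v = a (Fin.last ℓ)) :
    (shiM p).eval₂ (eval a) (u * v) =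
      ∏ k ∈ Iio p, (a k.castSucc - u) * (a k.castSucc - v) := by
  rw [shiM, Polynomial.eval₂_finsetProd]
  refine prod_congr rfl fun k _ => ?_
  rw [Polynomial.eval₂_add, Polynomial.eval₂_X, Polynomial.eval₂_C, map_mul, map_sub, eval_X,
    eval_X, ← huv]
  ring

/-- The fundamental identity for the basis derivations. -/
lemma sub_mul_delta (hq : (q : ℕ) = p + 1) (a : Fin (ℓ + 1) → ℝ) {u v : ℝ}
    (huv : u + v = a (Fin.last ℓ)) (hu : u ≠ 0) (hv : v ≠ 0) :
    (u - v) * (∑ n ∈ range ℓ,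
      eval a ((shiDelta (X (Fin.last ℓ)) (shiRoot p q ε) (shiR p q ε) (shiM p)).coeff n) *
        (u * v) ^ n - eval a (shiRoot p q ε * shiRho p q ε) * (∏ k : Fin ℓ, a k.castSucc) /
          (u * v)) =
      (a p.castSucc + ε * a q.castSucc - a (Fin.last ℓ)) *
        (∏ k ∈ Iio p, (a k.castSucc - u) * (a k.castSucc - v)) *
        ((shiR p q ε).eval₂ (eval a) u / u - (shiR p q ε).eval₂ (eval a) v / v) := by
  have h := eval_shiDelta (eval a) (z := X (Fin.last ℓ)) (by rw [eval_X, huv]) hu hv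
    (shiRoot p q ε) (shiR p q ε) (shiM p)
  have hdeg : (shiDelta (X (Fin.last ℓ)) (shiRoot p q ε) (shiR p q ε) (shiM p)).natDegree < ℓ := by
    have := q.2
    refine lt_of_le_of_lt (Polynomial.natDegree_le_iff_coeff_eq_zero.2 fun n hn => ?_)
      (show ℓ - 1 < ℓ by omega)
    exact (isWeightedHom_delta hq).coeff_eq_zero (by omega)
  rw [shiRoot_mul_coeff_zero hq, eval_shiM a huv, Polynomial.eval₂_eq_sum_range' _ hdeg, map_mul,
    map_prod] at h
  simp only [eval_X] at h
  rw [h, shiRoot]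
  simp

lemma shiCoeff_add_eq_zero (hq : (q : ℕ) = p + 1) (hε : ε = -1 ∨ ε = 1 ∧ (q : ℕ) + 1 = ℓ)
    {s t : Fin ℓ} (hst : s < t) {η : ℝ} (hη : η = 1 ∨ η = -1) (a : Fin (ℓ + 1) → ℝ)
    (ha : ∀ k, a k ≠ 0) (hne : a s.castSucc - η * a t.castSucc ≠ 0)
    (h : a s.castSucc + η * a t.castSucc = a (Fin.last ℓ)) :
    eval a (shiCoeff p q ε s) + η * eval a (shiCoeff p q ε t) = 0 := by
  have hη0 : η ≠ 0 := by rcases hη with rfl | rfl <;> norm_num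
  have hz := ha (Fin.last ℓ)
  rw [shiCoeff, shiCoeff, eval_shiValue _ _ (ha _), eval_shiValue _ _ (ha _)]
  set δ := fun n =>
    eval a ((shiDelta (X (Fin.last ℓ)) (shiRoot p q ε) (shiR p q ε) (shiM p)).coeff n)
  set κ := eval a (shiRoot p q ε * shiRho p q ε) * ∏ k : Fin ℓ, a k.castSucc
  have hodd : η * oddSum ℓ δ κ (a (Fin.last ℓ)) (a t.castSucc) =
      oddSum ℓ δ κ (a (Fin.last ℓ)) (η * a t.castSucc) := by
    rcases hη with rfl | rfl
    · simp
    · simp [oddSum_neg hz]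
  have hv : η * a t.castSucc ≠ 0 := mul_ne_zero hη0 (ha _)
  rw [hodd, oddSum_add hz h (ha _) hv]
  refine mul_eq_zero_of_right _ ((mul_eq_zero.1 ?_).resolve_left hne)
  rw [sub_mul_delta hq a h (ha _) hv, eval_shiR, eval_shiR]
  rcases lt_or_ge s p with hsp | hps
  · rw [prod_eq_zero (mem_Iio.2 hsp) (by simp)]
    simp
  have hRu : (a s.castSucc - a p.castSucc) * (a s.castSucc + ε * a q.castSucc) *
      ∏ k ∈ Ioi q, (a s.castSucc - a k.castSucc) * (a s.castSucc + a k.castSucc) = 0 := by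
    rcases lt_trichotomy s q with hsq | rfl | hqs
    · have : s = p := by
        rw [Fin.lt_def] at hsq; rw [Fin.le_def] at hps; ext; omega
      simp [this]
    · rcases hε with rfl | ⟨-, hl⟩
      · simp
      · have := t.2
        rw [Fin.lt_def] at hst; omega
    · rw [prod_eq_zero (mem_Ioi.2 hqs) (by simp)]
      simp
  rw [hRu]
  rcases lt_or_ge q t with hqt | htq
  · rw [prod_eq_zero (i := t) (mem_Ioi.2 hqt) (by rcases hη with rfl | rfl <;> simp)]
    simp
  have htq' : t = q := by
    rw [Fin.lt_def] at hst; rw [Fin.le_def] at hps htq; ext; omega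
  have hsp' : s = p := by
    rw [Fin.lt_def] at hst; rw [Fin.le_def] at hps htq; ext; omega
  subst htq' hsp'
  by_cases hηε : η = ε
  · subst hηε
    rw [h]
    simp
  · have : η = -ε := by
      rcases hη with rfl | rfl <;> rcases hε with rfl | ⟨rfl, -⟩ <;> simp_all
    simp [this]

lemma shiCoeff_add_eq_zero' {s t : Fin ℓ} {η : ℝ} (hη : η = 1 ∨ η = -1) (a : Fin (ℓ + 1) → ℝ)
    (ha : ∀ k, a k ≠ 0) (h : a s.castSucc + η * a t.castSucc = 0) :
    eval a (shiCoeff p q ε s) + η * eval a (shiCoeff p q ε t) = 0 := by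
  have hz := ha (Fin.last ℓ)
  rw [shiCoeff, shiCoeff, eval_shiValue _ _ (ha _), eval_shiValue _ _ (ha _)]
  rcases hη with rfl | rfl
  · rw [show a s.castSucc = -a t.castSucc by linarith, oddSum_neg hz]
    ring
  · rw [show a s.castSucc = a t.castSucc by linarith]
    ring

end ShiD

/-- Coefficient vectors of the defining linear forms. -/
def shiVec (ℓ : ℕ) : Option ({st : Fin ℓ × Fin ℓ // st.1 < st.2} × Bool × Bool) →
    Fin (ℓ + 1) → ℝ
  | none => Pi.single (Fin.last ℓ) 1
  | some (st, b, b') => Pi.single st.1.1.castSucc 1 +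
      (cond b 1 (-1) : ℝ) • Pi.single st.1.2.castSucc 1 -
      (cond b' 1 0 : ℝ) • Pi.single (Fin.last ℓ) 1

lemma linForm_single {n : ℕ} (i : Fin n) : linForm (Pi.single i 1) = X i := by
  simp [linForm, Pi.single_apply]

lemma linForm_add {n : ℕ} (c c' : Fin n → ℝ) : linForm (c + c') = linForm c + linForm c' := by
  simp [linForm, add_smul, sum_add_distrib]

lemma linForm_sub {n : ℕ} (c c' : Fin n → ℝ) : linForm (c - c') = linForm c - linForm c' := by
  simp [linForm, sub_smul, sum_sub_distrib]

lemma linForm_smul {n : ℕ} (r : ℝ) (c : Fin n → ℝ) : linForm (r • c) = C r * linForm c := by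
  simp [linForm, mul_smul, smul_sum, ← smul_eq_C_mul]

lemma linForm_shiVec_some {ℓ : ℕ} (st : {st : Fin ℓ × Fin ℓ // st.1 < st.2}) (b b' : Bool) :
    linForm (shiVec ℓ (some (st, b, b'))) = X st.1.1.castSucc +
      C (cond b 1 (-1) : ℝ) * X st.1.2.castSucc - C (cond b' 1 0 : ℝ) * X (Fin.last ℓ) := by
  rw [shiVec, linForm_sub, linForm_add, linForm_smul, linForm_smul, linForm_single,
    linForm_single, linForm_single]

lemma mem_forms_iff {ℓ : ℕ} (α : SS ℓ) : α ∈ forms ℓ ↔ ∃ i, linForm (shiVec ℓ i) = α := by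
  constructor
  · rintro (rfl | ⟨s, t, ε, hst, hε, h⟩)
    · exact ⟨none, linForm_single _⟩
    · obtain ⟨b, hb⟩ : ∃ b : Bool, (cond b 1 (-1) : ℝ) = ε := by
        rcases hε with rfl | rfl
        · exact ⟨true, rfl⟩
        · exact ⟨false, rfl⟩
      rcases h with rfl | rfl
      · exact ⟨some (⟨(s, t), hst⟩, b, true), by simp [linForm_shiVec_some, hb]⟩
      · exact ⟨some (⟨(s, t), hst⟩, b, false), by simp [linForm_shiVec_some, hb]⟩
  · rintro ⟨(_ | ⟨⟨⟨s, t⟩, hst⟩, b, b'⟩), rfl⟩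
    · exact Or.inl (linForm_single _)
    · refine Or.inr ⟨s, t, cond b 1 (-1), hst, by cases b <;> simp, ?_⟩
      rw [linForm_shiVec_some]
      cases b' <;> simp

lemma shiVec_some_apply_castSucc {ℓ : ℕ} (st : {st : Fin ℓ × Fin ℓ // st.1 < st.2}) (b b' : Bool)
    (k : Fin ℓ) : shiVec ℓ (some (st, b, b')) k.castSucc =
      (if k = st.1.1 then 1 else 0) + cond b 1 (-1) * (if k = st.1.2 then 1 else 0) := by
  simp [shiVec, Pi.single_apply, (Fin.castSucc_lt_last k).ne]

lemma shiVec_some_apply_last {ℓ : ℕ} (st : {st : Fin ℓ × Fin ℓ // st.1 < st.2}) (b b' : Bool) :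
    shiVec ℓ (some (st, b, b')) (Fin.last ℓ) = -cond b' 1 0 := by
  simp [shiVec, (Fin.castSucc_lt_last _).ne']

lemma shiVec_some_apply_fst {ℓ : ℕ} (st : {st : Fin ℓ × Fin ℓ // st.1 < st.2}) (b b' : Bool) :
    shiVec ℓ (some (st, b, b')) st.1.1.castSucc = 1 := by
  rw [shiVec_some_apply_castSucc, if_pos rfl, if_neg st.2.ne]
  simp

lemma shiVec_ne_zero {ℓ : ℕ} : ∀ i, ∃ k, shiVec ℓ i k ≠ 0
  | none => ⟨Fin.last ℓ, by simp [shiVec]⟩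
  | some (st, b, b') => ⟨st.1.1.castSucc, by rw [shiVec_some_apply_fst]; exact one_ne_zero⟩

lemma shiVec_not_dvd {ℓ : ℕ} : ∀ i j, i ≠ j →
    ¬ linForm (shiVec ℓ i) ∣ linForm (shiVec ℓ j)
  | none, none => fun h => absurd rfl h
  | none, some (st, b, b') => fun _ h => by
    have := linForm_dvd_linForm (j := Fin.last ℓ) (by simp [shiVec]) h st.1.1.castSucc
    rw [shiVec_some_apply_fst] at this
    simp [shiVec, (Fin.castSucc_lt_last _).ne] at this
  | some (st, b, b'), none => fun _ h => by
    have := linForm_dvd_linForm (shiVec_some_apply_fst st b b') h (Fin.last ℓ)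
    simp [shiVec, (Fin.castSucc_lt_last _).ne] at this
  | some (⟨(s, t), hst⟩, b, b'), some (⟨(s', t'), hst'⟩, e, e') => fun hne h => by
    have key := linForm_dvd_linForm (shiVec_some_apply_fst ⟨(s, t), hst⟩ b b') h
    have hs := key s'.castSucc
    have ht := key t'.castSucc
    have hl := key (Fin.last ℓ)
    simp only [shiVec_some_apply_castSucc, shiVec_some_apply_last] at hs ht hl hst hst'
    have hbn : ∀ b : Bool, (cond b 1 (-1) : ℝ) ≠ 0 := fun b => by cases b <;> norm_num
    rw [if_pos trivial, if_neg hst'.ne, mul_zero, add_zero] at hs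
    rw [if_pos trivial, if_neg hst'.ne', zero_add, mul_one] at ht
    have h1 : s' = s ∨ s' = t := by
      by_contra! hc
      rw [if_neg hc.1, if_neg hc.2] at hs
      simp at hs
    have h2 : t' = s ∨ t' = t := by
      by_contra! hc
      rw [if_neg hc.1, if_neg hc.2] at ht
      exact hbn e (by simpa using ht)
    obtain ⟨rfl, rfl⟩ : s' = s ∧ t' = t := by
      rw [Fin.lt_def] at hst hst'
      simp only [Fin.ext_iff] at h1 h2 ⊢
      omega
    rw [if_pos rfl, if_neg hst'.ne] at ht hl
    rw [if_neg hst'.ne', if_pos rfl] at ht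
    refine hne ?_
    have h3 : b = e := by
      revert ht
      cases b <;> cases e <;> norm_num
    have h4 : b' = e' := by
      revert hl
      cases b' <;> cases e' <;> norm_num
    rw [h3, h4]

lemma card_shiVec_index (ℓ : ℕ) :
    Fintype.card (Option ({st : Fin ℓ × Fin ℓ // st.1 < st.2} × Bool × Bool)) =
      ℓ * (2 * (ℓ - 1)) + 1 := by
  have h : Fintype.card {st : Fin ℓ × Fin ℓ // st.1 < st.2} = ∑ i ∈ range ℓ, i := by
    rw [Fintype.card_subtype, card_filter, ← univ_product_univ, sum_product_right,
      ← Fin.sum_univ_eq_sum_range (fun i => i)]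
    refine sum_congr rfl fun t _ => ?_
    rw [← card_filter, Finset.filter_gt_eq_Iio, Fin.card_Iio]
  have h2 := sum_range_id_mul_two ℓ
  rw [Fintype.card_option, Fintype.card_prod, h, Fintype.card_prod, Fintype.card_bool]
  linarith

section Derivations

variable {ℓ : ℕ} {p q : Fin ℓ} {ε : ℝ}

/-- The basis derivation attached to the simple root `x_p + ε x_q`. -/
def shiDer (p q : Fin ℓ) (ε : ℝ) : Derivation ℝ (SS ℓ) (SS ℓ) :=
  mkDerivation ℝ (Fin.lastCases 0 (shiCoeff p q ε))

lemma shiDer_X_castSucc (i : Fin ℓ) : shiDer p q ε (X i.castSucc) = shiCoeff p q ε i := by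
  rw [shiDer, mkDerivation_X, Fin.lastCases_castSucc]

lemma shiDer_X_last : shiDer p q ε (X (Fin.last ℓ)) = 0 := by
  rw [shiDer, mkDerivation_X, Fin.lastCases_last]

lemma linForm_dvd_shiDer (hq : (q : ℕ) = p + 1) (hε : ε = -1 ∨ ε = 1 ∧ (q : ℕ) + 1 = ℓ) :
    ∀ i, linForm (shiVec ℓ i) ∣ shiDer p q ε (linForm (shiVec ℓ i))
  | none => by
    rw [shiVec, linForm_single, shiDer_X_last]
    exact dvd_zero _
  | some (⟨(s, t), hst⟩, b, b') => by
    have hst' : s < t := hst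
    set η : ℝ := cond b 1 (-1) with hη
    have hη1 : η = 1 ∨ η = -1 := by cases b <;> simp [hη]
    have hsum : ∀ a : Fin (ℓ + 1) → ℝ, ∑ k, shiVec ℓ (some (⟨(s, t), hst⟩, b, b')) k * a k =
        a s.castSucc + η * a t.castSucc - (cond b' 1 0 : ℝ) * a (Fin.last ℓ) := fun a => by
      rw [← eval_linForm, linForm_shiVec_some]
      simp [hη]
    have hF : shiDer p q ε (linForm (shiVec ℓ (some (⟨(s, t), hst⟩, b, b')))) =
        shiCoeff p q ε s + C η * shiCoeff p q ε t := by
      rw [linForm_shiVec_some, map_sub, map_add, ← smul_eq_C_mul, ← smul_eq_C_mul,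
        Derivation.map_smul, Derivation.map_smul, shiDer_X_castSucc, shiDer_X_castSucc,
        shiDer_X_last, smul_zero, sub_zero, smul_eq_C_mul]
    rw [hF]
    refine linForm_dvd_of_generic (shiVec_ne_zero _) _
      ((∏ k, X k) * (X s.castSucc - C η * X t.castSucc))
      (Function.update (Function.update 1 t.castSucc 2) s.castSucc (cond b' 1 0 - 2 * η)) ?_ ?_ ?_
    · rw [hsum, Function.update_self, Function.update_of_ne (by simpa using hst'.ne'),
        Function.update_self, Function.update_of_ne (Fin.castSucc_lt_last _).ne',
        Function.update_of_ne (Fin.castSucc_lt_last _).ne']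
      simp
      ring
    · have h0 : (cond b' 1 0 - 2 * η : ℝ) ≠ 0 := by
        cases b' <;> cases b <;> norm_num [hη]
      rw [map_mul, map_prod, map_sub, map_mul, eval_C, eval_X, eval_X, Function.update_self,
        Function.update_of_ne (by simpa using hst'.ne'), Function.update_self]
      refine mul_ne_zero (Finset.prod_ne_zero_iff.2 fun k _ => ?_) ?_
      · rw [eval_X, Function.update_apply, Function.update_apply]
        split_ifs
        · exact h0
        · exact two_ne_zero
        · exact one_ne_zero
      · cases b' <;> cases b <;> norm_num [hη]
    · intro a ha hN
      rw [map_mul, map_prod, map_sub, map_mul, eval_C, eval_X, eval_X, mul_ne_zero_iff,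
        Finset.prod_ne_zero_iff] at hN
      have ha0 : ∀ k, a k ≠ 0 := fun k => by simpa using hN.1 k (mem_univ k)
      rw [hsum] at ha
      rw [map_add, map_mul, eval_C]
      cases b'
      · exact shiCoeff_add_eq_zero' hη1 a ha0 (by simpa using ha)
      · exact shiCoeff_add_eq_zero hq hε hst' hη1 a ha0 hN.2
          (by rw [cond_true, one_mul] at ha; linarith)

end Derivations

section Independence

variable {m : ℕ}

/-- The first index of the `j`-th simple root. -/
def fstIdx (j : Fin (m + 2)) : Fin (m + 2) := ⟨min (j : ℕ) m, by omega⟩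

/-- The second index of the `j`-th simple root. -/
def sndIdx (j : Fin (m + 2)) : Fin (m + 2) := ⟨min (j : ℕ) m + 1, by omega⟩

/-- The sign of the `j`-th simple root. -/
def sgnIdx (j : Fin (m + 2)) : ℝ := if (j : ℕ) ≤ m then -1 else 1

lemma sndIdx_eq (j : Fin (m + 2)) : (sndIdx j : ℕ) = fstIdx j + 1 := rfl

lemma sgnIdx_spec (j : Fin (m + 2)) :
    sgnIdx j = -1 ∨ sgnIdx j = 1 ∧ (sndIdx j : ℕ) + 1 = m + 2 := by
  have := j.2
  rw [sgnIdx, sndIdx]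
  split_ifs with h
  · exact Or.inl rfl
  · exact Or.inr ⟨rfl, by simp only; omega⟩

/-- The polynomials giving, at `z = 0`, the derivatives of the basis derivations are linearly
independent. -/
lemma eq_zero_of_interpolation (a : Fin (m + 2) → ℝ) (ha : ∀ k, 0 < a k)
    (hinj : Function.Injective a) (c : Fin (m + 2) → ℝ)
    (h : ∀ k, ∑ j, c j * ((a (fstIdx j) + sgnIdx j * a (sndIdx j)) *
      (∏ i ∈ Iio (fstIdx j), (a i ^ 2 - a k ^ 2)) *
      (a k ^ 2 - sgnIdx j * (a (fstIdx j) * a (sndIdx j))) *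
      ∏ i ∈ Ioi (sndIdx j), (a k ^ 2 - a i ^ 2)) = 0) : c = 0 := by
  have hsq : ∀ i k, i ≠ k → a i ^ 2 - a k ^ 2 ≠ 0 := fun i k hik h0 => by
    have h1 : (a i - a k) * (a i + a k) = 0 := by linear_combination h0
    rcases mul_eq_zero.1 h1 with h1 | h1
    · exact hik (hinj (sub_eq_zero.1 h1))
    · linarith [ha i, ha k]
  have hsub : ∀ i k, i ≠ k → a i - a k ≠ 0 := fun i k hik h0 => hik (hinj (sub_eq_zero.1 h0))
  have hlow : ∀ n, ∀ j : Fin (m + 2), (j : ℕ) = n → n < m → c j = 0 := by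
    intro n
    induction n using Nat.strong_induction_on with
    | _ n ih =>
      intro j hj hn
      have hk := h j
      have hfst : fstIdx j = j := Fin.ext (by simp [fstIdx]; omega)
      have hsgn : sgnIdx j = -1 := by rw [sgnIdx, if_pos (by omega)]
      have hsnd : (sndIdx j : ℕ) = n + 1 := by rw [sndIdx_eq, hfst, hj]
      rw [sum_eq_single j] at hk
      · refine (mul_eq_zero.1 hk).resolve_right (mul_ne_zero (mul_ne_zero (mul_ne_zero ?_ ?_) ?_) ?_)
        · rw [hfst, hsgn, neg_one_mul, ← sub_eq_add_neg]
          exact hsub _ _ (by rw [Ne, Fin.ext_iff]; omega)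
        · refine prod_ne_zero_iff.2 fun i hi => hsq _ _ ?_
          rw [hfst, mem_Iio] at hi
          exact hi.ne
        · rw [hfst, hsgn]
          have := mul_pos (ha j) (ha (sndIdx j))
          have := pow_pos (ha j) 2
          linarith
        · refine prod_ne_zero_iff.2 fun i hi => hsq _ _ ?_
          rw [mem_Ioi, Fin.lt_def] at hi
          rw [Ne, Fin.ext_iff]
          omega
      · intro i _ hij
        rw [Ne, Fin.ext_iff] at hij
        rcases lt_or_gt_of_ne hij with hlt | hgt
        · rw [ih i (by omega) i rfl (by omega), zero_mul]
        · have : j ∈ Iio (fstIdx i) := by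
            rw [mem_Iio, Fin.lt_def]
            simp only [fstIdx]
            omega
          rw [prod_eq_zero this (sub_self _)]
          simp
      · simp
  let x : Fin (m + 2) := ⟨m, by omega⟩
  let y : Fin (m + 2) := Fin.last (m + 1)
  have hxy : x ≠ y := by rw [Ne, Fin.ext_iff]; simp [x, y]
  have hx : fstIdx x = x ∧ sndIdx x = y ∧ sgnIdx x = -1 := by
    simp [fstIdx, sndIdx, sgnIdx, Fin.ext_iff, x, y]
  have hy : fstIdx y = x ∧ sndIdx y = y ∧ sgnIdx y = 1 := by
    simp [fstIdx, sndIdx, sgnIdx, Fin.ext_iff, x, y]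
  have htop : Ioi y = ∅ := by
    ext i
    have := i.2
    simp only [mem_Ioi, Fin.lt_def, y, Fin.val_last]
    simp
    omega
  have hred : ∀ k, k = x ∨ k = y → c x * ((a x - a y) * (a k ^ 2 + a x * a y)) +
      c y * ((a x + a y) * (a k ^ 2 - a x * a y)) = 0 := by
    intro k hkxy
    have hk := h k
    rw [sum_eq_add x y hxy (fun i _ hi => by
      rw [hlow i i rfl ?_, zero_mul]
      have := i.2
      simp only [Ne, Fin.ext_iff, x, y, Fin.val_last] at hi
      omega) (by simp) (by simp)] at hk
    rw [hx.1, hx.2.1, hx.2.2, hy.1, hy.2.1, hy.2.2, htop, prod_empty] at hk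
    have hP : ∏ i ∈ Iio x, (a i ^ 2 - a k ^ 2) ≠ 0 := by
      refine prod_ne_zero_iff.2 fun i hi => hsq _ _ ?_
      rw [mem_Iio] at hi
      rcases hkxy with rfl | rfl
      · exact hi.ne
      · exact (hi.trans (lt_of_le_of_ne (Fin.le_last _) hxy)).ne
    refine (mul_eq_zero.1 ?_).resolve_left hP
    linear_combination hk
  have h1 := hred x (Or.inl rfl)
  have h2 := hred y (Or.inr rfl)
  have hs := hsub x y hxy
  have hp : a x + a y ≠ 0 := by linarith [ha x, ha y]
  have h1' : c x + c y = 0 := by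
    refine (mul_eq_zero.1 ?_).resolve_left (mul_ne_zero (mul_ne_zero hs hp) (ha x).ne')
    linear_combination h1
  have h2' : c x - c y = 0 := by
    refine (mul_eq_zero.1 ?_).resolve_left (mul_ne_zero (mul_ne_zero hs hp) (ha y).ne')
    linear_combination h2
  funext j
  rcases lt_trichotomy (j : ℕ) m with hj | hj | hj
  · exact hlow j j rfl hj
  · rw [show j = x from Fin.ext hj, Pi.zero_apply]
    linarith
  · have := j.2
    rw [show j = y from Fin.ext (by simp [y]; omega), Pi.zero_apply]
    linarith

end Independence

section Determinant

variable {m : ℕ}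

lemma eval_shiCoeff_zero {ℓ : ℕ} (p q : Fin ℓ) (ε : ℝ) {a : Fin ℓ → ℝ} (ha : ∀ k, a k ≠ 0)
    (i : Fin ℓ) : eval (Fin.snoc a 0 : Fin (ℓ + 1) → ℝ) (shiCoeff p q ε i) * a i =
      ∑ n ∈ range ℓ, eval (Fin.snoc a 0 : Fin (ℓ + 1) → ℝ) ((shiDelta (X (Fin.last ℓ))
        (shiRoot p q ε) (shiR p q ε) (shiM p)).coeff n) * (oddBern n).coeff (2 * n + 1) *
        (a i ^ 2) ^ (n + 1) -
      eval (Fin.snoc a 0 : Fin (ℓ + 1) → ℝ) (shiRoot p q ε * shiRho p q ε) * ∏ k, a k := by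
  rw [shiCoeff, eval_shiValue _ _ (by rw [Fin.snoc_castSucc]; exact ha i), oddSum, sub_mul,
    sum_mul]
  simp only [Fin.snoc_castSucc, Fin.snoc_last, homBern_zero_right]
  rw [div_mul_cancel₀ _ (ha i)]
  congr 1
  refine sum_congr rfl fun n _ => ?_
  ring

lemma sub_mul_delta_zero {ℓ : ℕ} {p q : Fin ℓ} (ε : ℝ) (hq : (q : ℕ) = p + 1) (a : Fin ℓ → ℝ)
    {x : ℝ} (hx : x ≠ 0) :
    x ^ 2 * (∑ n ∈ range ℓ, eval (Fin.snoc a 0 : Fin (ℓ + 1) → ℝ) ((shiDelta (X (Fin.last ℓ))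
        (shiRoot p q ε) (shiR p q ε) (shiM p)).coeff n) * (-x ^ 2) ^ n) +
      eval (Fin.snoc a 0 : Fin (ℓ + 1) → ℝ) (shiRoot p q ε * shiRho p q ε) * ∏ k, a k =
      (a p + ε * a q) * (∏ i ∈ Iio p, (a i ^ 2 - x ^ 2)) * (x ^ 2 - ε * (a p * a q)) *
        ∏ i ∈ Ioi q, (x ^ 2 - a i ^ 2) := by
  have h := sub_mul_delta (ε := ε) hq (Fin.snoc a 0 : Fin (ℓ + 1) → ℝ) (u := x) (v := -x)
    (by simp) hx (neg_ne_zero.2 hx)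
  rw [eval_shiR, eval_shiR] at h
  simp only [Fin.snoc_castSucc, Fin.snoc_last, sub_zero] at h
  have h1 : ∏ i ∈ Iio p, (a i - x) * (a i - -x) = ∏ i ∈ Iio p, (a i ^ 2 - x ^ 2) :=
    prod_congr rfl fun i _ => by ring
  have h2 : ∏ i ∈ Ioi q, (x - a i) * (x + a i) = ∏ i ∈ Ioi q, (x ^ 2 - a i ^ 2) :=
    prod_congr rfl fun i _ => by ring
  have h3 : ∏ i ∈ Ioi q, (-x - a i) * (-x + a i) = ∏ i ∈ Ioi q, (x ^ 2 - a i ^ 2) :=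
    prod_congr rfl fun i _ => by ring
  rw [h1, h2, h3, show x * -x = -x ^ 2 by ring] at h
  generalize ∏ i ∈ Iio p, (a i ^ 2 - x ^ 2) = P at h ⊢
  generalize ∏ i ∈ Ioi q, (x ^ 2 - a i ^ 2) = P' at h ⊢
  generalize (∑ n ∈ range ℓ, _ : ℝ) = T at h ⊢
  generalize eval (Fin.snoc a 0 : Fin (ℓ + 1) → ℝ) (shiRoot p q ε * shiRho p q ε) = K at h ⊢
  field_simp at h
  linear_combination h / 2

lemma eq_zero_of_sum_shiCoeff {a : Fin (m + 2) → ℝ} (ha : ∀ k, 0 < a k)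
    (hinj : Function.Injective a) {c : Fin (m + 2) → ℝ}
    (h : ∀ i, ∑ j, c j * eval (Fin.snoc a 0 : Fin (m + 2 + 1) → ℝ)
      (shiCoeff (fstIdx j) (sndIdx j) (sgnIdx j) i) = 0) : c = 0 := by
  set δ : Fin (m + 2) → ℕ → ℝ := fun j n => eval (Fin.snoc a 0 : Fin (m + 2 + 1) → ℝ)
    ((shiDelta (X (Fin.last (m + 2))) (shiRoot (fstIdx j) (sndIdx j) (sgnIdx j))
      (shiR (fstIdx j) (sndIdx j) (sgnIdx j)) (shiM (fstIdx j))).coeff n) with hδ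
  set κ : Fin (m + 2) → ℝ := fun j => eval (Fin.snoc a 0 : Fin (m + 2 + 1) → ℝ)
    (shiRoot (fstIdx j) (sndIdx j) (sgnIdx j) * shiRho (fstIdx j) (sndIdx j) (sgnIdx j)) *
      ∏ k, a k with hκ
  set γ : ℕ → ℝ := fun n => (oddBern n).coeff (2 * n + 1) with hγ
  set Q : Polynomial ℝ := ∑ n ∈ range (m + 1),
    Polynomial.C ((∑ j, c j * δ j n) * γ n) * Polynomial.X ^ (n + 1) -
      Polynomial.C (∑ j, c j * κ j) with hQ
  have hδ0 : ∀ j, δ j (m + 1) = 0 := fun j => by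
    simp only [hδ]
    rw [(isWeightedHom_delta (sndIdx_eq j)).coeff_eq_zero (by omega), map_zero]
  have hQ0 : Q = 0 := by
    refine Polynomial.eq_zero_of_natDegree_lt_card_of_eval_eq_zero Q (f := fun k => a k ^ 2)
      (fun i k hik => hinj ((pow_left_inj₀ (ha i).le (ha k).le two_ne_zero).1 hik)) (fun k => ?_) ?_
    · have hk : ∑ j, c j * (∑ n ∈ range (m + 2), δ j n * γ n * (a k ^ 2) ^ (n + 1) - κ j) = 0 := by
        have := congrArg (· * a k) (h k)
        simp only [sum_mul, zero_mul, mul_assoc (c _),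
          eval_shiCoeff_zero _ _ _ (fun k => (ha k).ne')] at this
        exact this
      rw [← hk, hQ]
      simp only [Polynomial.eval_sub, Polynomial.eval_finsetSum, Polynomial.eval_mul,
        Polynomial.eval_pow, Polynomial.eval_X, Polynomial.eval_C, mul_sub, sum_sub_distrib,
        sum_mul, mul_sum]
      rw [sum_comm]
      congr 1
      refine sum_congr rfl fun j _ => ?_
      rw [sum_range_succ _ (m + 1), hδ0]
      simp [mul_assoc]
    · rw [Fintype.card_fin]
      refine lt_of_le_of_lt (b := m + 1) ?_ (by omega)
      refine (Polynomial.natDegree_sub_le _ _).trans (max_le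
        (Polynomial.natDegree_sum_le_of_forall_le _ _
          fun n hn => (Polynomial.natDegree_C_mul_X_pow_le _ _).trans ?_)
        (by rw [Polynomial.natDegree_C]; exact Nat.zero_le _))
      rw [mem_range] at hn
      omega
  have hcoeff : ∀ n, ∑ j, c j * δ j n = 0 ∨ m + 1 < n := fun n => by
    rcases lt_trichotomy n (m + 1) with hn | rfl | hn
    · left
      have := congrArg (fun P => P.coeff (n + 1)) hQ0
      simp only [hQ, Polynomial.coeff_sub, Polynomial.finsetSum_coeff, Polynomial.coeff_C_mul_X_pow,
        Polynomial.coeff_C_succ, Polynomial.coeff_zero, sub_zero, add_left_inj, sum_ite_eq,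
        mem_range, hn, if_true] at this
      exact (mul_eq_zero.1 this).resolve_right (oddBern_spec n).2.2.2
    · left
      simp [hδ0]
    · exact Or.inr hn
  have hconst : ∑ j, c j * κ j = 0 := by
    have := congrArg (fun P => P.coeff 0) hQ0
    simpa [hQ, Polynomial.coeff_C_mul, Polynomial.coeff_X_pow] using this
  refine eq_zero_of_interpolation a ha hinj c fun k => ?_
  simp only [← sub_mul_delta_zero (sgnIdx _) (sndIdx_eq _) a (ha k).ne', mul_add, sum_add_distrib]
  refine (congrArg₂ (· + ·) ?_ hconst).trans (add_zero 0)
  have : ∀ j, c j * (a k ^ 2 * ∑ n ∈ range (m + 2), δ j n * (-a k ^ 2) ^ n) =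
      ∑ n ∈ range (m + 2), (c j * δ j n) * (a k ^ 2 * (-a k ^ 2) ^ n) := fun j => by
    rw [mul_sum, mul_sum]
    exact sum_congr rfl fun n _ => by ring
  refine (sum_congr rfl fun j _ => this j).trans ?_
  rw [sum_comm]
  refine sum_eq_zero fun n hn => ?_
  rw [← sum_mul, (hcoeff n).resolve_right (by rw [mem_range] at hn; omega), zero_mul]

/-- The Euler derivation. -/
def eulerDer (n : ℕ) : Derivation ℝ (MvPolynomial (Fin n) ℝ) (MvPolynomial (Fin n) ℝ) :=
  mkDerivation ℝ X

lemma eulerDer_X {n : ℕ} (i : Fin n) : eulerDer n (X i) = X i := mkDerivation_X _ _ _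

lemma eulerDer_linForm {n : ℕ} (c : Fin n → ℝ) : eulerDer n (linForm c) = linForm c := by
  simp [eulerDer_X, linForm]

/-- The basis of the derivation module; the Euler derivation comes last. -/
def shiBasis (m : ℕ) : Fin (m + 2 + 1) → Derivation ℝ (SS (m + 2)) (SS (m + 2)) :=
  Fin.snoc (fun j => shiDer (fstIdx j) (sndIdx j) (sgnIdx j)) (eulerDer _)

lemma shiBasis_castSucc (j : Fin (m + 2)) :
    shiBasis m j.castSucc = shiDer (fstIdx j) (sndIdx j) (sgnIdx j) := by
  rw [shiBasis, Fin.snoc_castSucc]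

lemma shiBasis_last : shiBasis m (Fin.last _) = eulerDer _ := by
  rw [shiBasis, Fin.snoc_last]

lemma det_shiBasis_ne_zero :
    (Matrix.of fun j k => shiBasis m j (X k)).det ≠ 0 := by
  intro h
  obtain ⟨v, hv, hv0⟩ := Matrix.exists_vecMul_eq_zero_iff.2 h
  have hcol : ∀ k, ∑ j : Fin (m + 2), v j.castSucc * shiDer (fstIdx j) (sndIdx j) (sgnIdx j) (X k) +
      v (Fin.last _) * X k = 0 := fun k => by
    have := congrFun hv0 k
    simpa [Matrix.vecMul, dotProduct, Fin.sum_univ_castSucc, shiBasis_castSucc, shiBasis_last,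
      eulerDer_X] using this
  have hlast : v (Fin.last _) = 0 := by
    have := hcol (Fin.last _)
    simpa [shiDer_X_last, X_ne_zero] using this
  let M : Matrix (Fin (m + 2)) (Fin (m + 2)) (SS (m + 2)) :=
    Matrix.of fun j i => shiCoeff (fstIdx j) (sndIdx j) (sgnIdx j) i
  have hM : M.det = 0 := by
    refine Matrix.exists_vecMul_eq_zero_iff.1 ⟨fun j => v j.castSucc, fun hv' => hv ?_, ?_⟩
    · funext j
      refine Fin.lastCases hlast (fun j => congrFun hv' j) j
    · funext i
      have := hcol i.castSucc
      simpa [hlast, shiDer_X_castSucc, M, Matrix.vecMul, dotProduct] using this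
  let a : Fin (m + 2) → ℝ := fun i => i + 1
  have hM' : ((eval (Fin.snoc a 0 : Fin (m + 2 + 1) → ℝ)).mapMatrix M).det = 0 := by
    rw [← RingHom.map_det, hM, map_zero]
  obtain ⟨c, hc, hc0⟩ := Matrix.exists_vecMul_eq_zero_iff.2 hM'
  refine hc (eq_zero_of_sum_shiCoeff (a := a) (fun k => by positivity) (fun i k hik => ?_)
    fun i => congrFun hc0 i)
  simpa [a, Fin.ext_iff] using hik

end Determinant

/-- Let `ℓ ≥ 2`.  The `S`-module `D(cS(D_ℓ))` is free of rank `ℓ+1`, admitting a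
homogeneous basis with one derivation of degree `1` and `ℓ` derivations of degree
`2(ℓ−1)`: the cone over the Shi arrangement of type `D_ℓ` is free with exponents
`(1, 2ℓ−2, …, 2ℓ−2)` (`2ℓ−2` occurring `ℓ` times). -/
theorem coneShiD_free (ℓ : ℕ) (hℓ : 2 ≤ ℓ) :
    ∃ (e : Derivation ℝ (SS ℓ) (SS ℓ)) (f : Fin ℓ → Derivation ℝ (SS ℓ) (SS ℓ)),
      (∀ α ∈ forms ℓ, α ∣ e α) ∧ (∀ j : Fin ℓ, ∀ α ∈ forms ℓ, α ∣ f j α) ∧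
      IsHomogeneousDer ℓ e 1 ∧ (∀ j : Fin ℓ, IsHomogeneousDer ℓ (f j) (2 * (ℓ - 1))) ∧
      ∀ θ : Derivation ℝ (SS ℓ) (SS ℓ), (∀ α ∈ forms ℓ, α ∣ θ α) →
        ∃! c : Fin (ℓ + 1) → SS ℓ,
          θ = c (Fin.last ℓ) • e + ∑ j : Fin ℓ, c j.castSucc • f j := by
  obtain ⟨m, rfl⟩ := Nat.exists_eq_add_of_le' hℓ
  have he : ∀ i, linForm (shiVec (m + 2) i) ∣ eulerDer _ (linForm (shiVec (m + 2) i)) :=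
    fun i => (eulerDer_linForm _).symm ▸ dvd_rfl
  have hf (j : Fin (m + 2)) := linForm_dvd_shiDer (sndIdx_eq j) (sgnIdx_spec j)
  have he1 : ∀ k : Fin (m + 2 + 1), (eulerDer _ (X k)).IsHomogeneous 1 := fun k => by
    rw [eulerDer_X]
    exact isHomogeneous_X _ _
  have hf1 : ∀ (j : Fin (m + 2)) k, (shiDer (fstIdx j) (sndIdx j) (sgnIdx j) (X k)).IsHomogeneous
      (2 * (m + 2 - 1)) := fun j k => by
    refine Fin.lastCases ?_ (fun i => ?_) k
    · rw [shiDer_X_last]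
      exact isHomogeneous_zero _ _ _
    · rw [shiDer_X_castSucc]
      exact isHomogeneous_shiCoeff (sndIdx_eq j) i
  refine ⟨eulerDer _, fun j => shiDer (fstIdx j) (sndIdx j) (sgnIdx j), ?_, ?_,
    fun k => Or.inr (he1 k), fun j k => Or.inr (hf1 j k), fun θ hθ => ?_⟩
  · rintro α hα
    obtain ⟨i, rfl⟩ := (mem_forms_iff α).1 hα
    exact he i
  · rintro j α hα
    obtain ⟨i, rfl⟩ := (mem_forms_iff α).1 hα
    exact hf j i
  · have h := existsUnique_of_saito (shiVec (m + 2)) shiVec_ne_zero shiVec_not_dvd (shiBasis m)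
      (Fin.lastCases (by simpa only [shiBasis_last] using he)
        fun j => by simpa only [shiBasis_castSucc] using hf j)
      (Fin.snoc (fun _ => 2 * (m + 2 - 1)) 1)
      (Fin.lastCases (by simpa only [shiBasis_last, Fin.snoc_last] using he1)
        fun j => by simpa only [shiBasis_castSucc, Fin.snoc_castSucc] using hf1 j)
      (by rw [card_shiVec_index, Fin.sum_univ_castSucc]; simp) det_shiBasis_ne_zero θ
      fun i => hθ _ ((mem_forms_iff _).2 ⟨i, rfl⟩)
    simpa only [Fin.sum_univ_castSucc, shiBasis_castSucc, shiBasis_last, add_comm] using h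

end
end

section
/- Let ℓ ≥ 2. Then det[(φ_j(x_i))_{1≤i,j≤ℓ}] = (1/(2ℓ−3)!!) · ∏_{1≤s<t≤ℓ} ∏_{ε∈{−1,1}} (x_s + εx_t − z)(x_s + εx_t), where (2ℓ−3)!! = ∏_{m=1}^{ℓ−1}(2m−1). -/
open MvPolynomial Finset

noncomputable section

/-- Elementary symmetric function of degree `n` of the values of `f` on the finite set `s`. -/
def esymVal {α R : Type*} [CommSemiring R] (s : Finset α) (f : α → R) (n : ℕ) : R :=
  ∑ t ∈ Finset.powersetCard n s, ∏ a ∈ t, f a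

/-- The characterizing conditions for the family of Bernoulli-like polynomials `B p q`
(for `p ≥ -1`, `q ≥ 0`, `(p,q) ≠ (-1,0)`):  oddness and the (denominator-cleared)
difference equations. -/
def BProp (B : ℤ → ℕ → Polynomial ℝ) : Prop :=
  (∀ (p : ℤ) (q : ℕ), -1 ≤ p → ¬(p = -1 ∧ q = 0) →
      (B p q).comp (-Polynomial.X) = -(B p q)) ∧
  (∀ (p q : ℕ),
      (2 * Polynomial.X + 1) * ((B p q).comp (Polynomial.X + 1) - B p q)
        = ((Polynomial.X + 1) ^ p - (-Polynomial.X) ^ p)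
            * (Polynomial.X + 1) ^ q * (-Polynomial.X) ^ q) ∧
  (∀ q : ℕ, 1 ≤ q →
      (B (-1) q).comp (Polynomial.X + 1) - B (-1) q
        = -((-Polynomial.X) * (Polynomial.X + 1)) ^ (q - 1))

/-- The field of rational functions, in which the defining formulas for the `φ_j` live. -/
abbrev KK (ℓ : ℕ) := FractionRing (SS ℓ)

/-- `x_{i+1}` as a rational function. -/
def xx (ℓ : ℕ) (i : Fin ℓ) : KK ℓ := algebraMap (SS ℓ) (KK ℓ) (X i.castSucc)

/-- `z` as a rational function. -/
def zz (ℓ : ℕ) : KK ℓ := algebraMap (SS ℓ) (KK ℓ) (X (Fin.last ℓ))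

/-- `ar B_{p,q}(x, z) = z^{p+2q}·B_{p,q}(x/z)`, as a rational function; by convention
`ar B_{-1,0}(x,z) = -1/x`. -/
def arB (B : ℤ → ℕ → Polynomial ℝ) (ℓ : ℕ) (p : ℤ) (q : ℕ) (x : KK ℓ) : KK ℓ :=
  if p = -1 ∧ q = 0 then -x⁻¹
  else zz ℓ ^ (p + 2 * (q : ℤ)) *
    Polynomial.eval₂ ((algebraMap (SS ℓ) (KK ℓ)).comp (MvPolynomial.C)) (x / zz ℓ) (B p q)

/-- `J = {x_1, …, x_{j-1}}` (as a set of indices). -/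
def Jset (ℓ : ℕ) (j : Fin ℓ) : Finset (Fin ℓ) := univ.filter (· < j)

/-- The value `φ_j(x_i)` (an element of the fraction field, which is in fact
a polynomial).  Here `j` with `(j:ℕ)+1 < ℓ` encodes `φ_{j+1}`, `1 ≤ j+1 ≤ ℓ-1`,
and `j = Fin.last` encodes `φ_ℓ`. -/
def phi (B : ℤ → ℕ → Polynomial ℝ) (ℓ : ℕ) (j i : Fin ℓ) : KK ℓ :=
  if h : (j : ℕ) + 1 < ℓ then
    (xx ℓ j - xx ℓ ⟨(j : ℕ) + 1, h⟩ - zz ℓ) *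
      ∑ K1 ∈ (Jset ℓ j).powerset, ∑ K2 ∈ ((Jset ℓ j) \ K1).powerset,
        (∏ a ∈ K1, xx ℓ a) * (∏ a ∈ K2, xx ℓ a) ^ 2 * (-zz ℓ) ^ K1.card *
          ∑ n1 ∈ Finset.range 3, ∑ n2 ∈ Finset.range (ℓ - (j : ℕ) - 1),
            (-1 : KK ℓ) ^ (n1 + n2) *
              esymVal ({j, ⟨(j : ℕ) + 1, h⟩} : Finset (Fin ℓ)) (xx ℓ) n1 *
              esymVal (univ.filter (fun a : Fin ℓ => (j : ℕ) + 1 < (a : ℕ)))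
                (fun a => xx ℓ a ^ 2) n2 *
              arB B ℓ ((2 - (n1 : ℤ)) + 2 * ((ℓ : ℤ) - (j : ℤ) - 2 - (n2 : ℤ)) - 1)
                ((j : ℕ) - K1.card - K2.card) (xx ℓ i)
  else
    ∑ K1 ∈ (Jset ℓ j).powerset, ∑ K2 ∈ ((Jset ℓ j) \ K1).powerset,
      (∏ a ∈ K1, xx ℓ a) * (∏ a ∈ K2, xx ℓ a) ^ 2 * (-zz ℓ) ^ K1.card * (-(xx ℓ j)) *
        arB B ℓ (-1) ((j : ℕ) - K1.card - K2.card) (xx ℓ i)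


section Bernoulli

/-- An odd real polynomial with period `1` vanishes. -/
lemma eq_zero_of_odd_of_periodic {P : Polynomial ℝ} (hodd : P.comp (-Polynomial.X) = -P)
    (hper : P.comp (Polynomial.X + 1) = P) : P = 0 := by
  have h0 : P.eval 0 = 0 := by
    have := congrArg (Polynomial.eval 0) hodd
    simp at this
    linarith
  have hn : ∀ n : ℕ, P.eval (n : ℝ) = 0 := by
    intro n
    induction n with
    | zero => simpa using h0
    | succ k ih =>
      have := congrArg (Polynomial.eval (k : ℝ)) hper
      simp at this
      rw [Nat.cast_succ, this, ih]
  refine Polynomial.eq_zero_of_infinite_isRoot P ?_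
  exact (Set.infinite_range_of_injective (Nat.cast_injective (R := ℝ))).mono
    (by rintro _ ⟨n, rfl⟩; exact hn n)

lemma two_mul_X_add_one_ne_zero : (2 * Polynomial.X + 1 : Polynomial ℝ) ≠ 0 := by
  intro h
  have := congrArg (Polynomial.eval 0) h
  simp at this

variable {B : ℤ → ℕ → Polynomial ℝ}

lemma BProp.zero_left (hB : BProp B) (q : ℕ) : B 0 q = 0 := by
  refine eq_zero_of_odd_of_periodic (hB.1 0 q (by norm_num) (by norm_num)) ?_
  have h := hB.2.1 0 q
  simp only [pow_zero, sub_self, zero_mul, Nat.cast_zero] at h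
  exact sub_eq_zero.1 ((mul_eq_zero.1 h).resolve_left two_mul_X_add_one_ne_zero)

lemma BProp.neg_one_diff (hB : BProp B) (q : ℕ) :
    (B (-1) (q + 1)).comp (Polynomial.X + 1) - B (-1) (q + 1)
      = -((-Polynomial.X) * (Polynomial.X + 1)) ^ q := by
  simpa using hB.2.2 (q + 1) (by omega)

/-- The three-term recurrence `B_{p+1,q} = B_{p,q} - B_{p-1,q+1}`, indexed by `n = p`. -/
lemma BProp.recurrence (hB : BProp B) (n q : ℕ) :
    B ((n : ℤ) + 1) q = B n q - B ((n : ℤ) - 1) (q + 1) := by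
  rw [← sub_eq_zero]
  apply eq_zero_of_odd_of_periodic
  · simp only [Polynomial.sub_comp]
    rw [hB.1 _ q (by omega) (by omega), hB.1 _ q (by omega) (by omega),
      hB.1 _ (q + 1) (by omega) (by omega)]
    ring
  · simp only [Polynomial.sub_comp]
    have h1 := hB.2.1 (n + 1) q
    have h2 := hB.2.1 n q
    have h3 : (2 * Polynomial.X + 1) * ((B ((n : ℤ) - 1) (q + 1)).comp (Polynomial.X + 1)
        - B ((n : ℤ) - 1) (q + 1)) = ((-Polynomial.X) * (Polynomial.X + 1) ^ n
            - (Polynomial.X + 1) * (-Polynomial.X) ^ n)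
            * (Polynomial.X + 1) ^ q * (-Polynomial.X) ^ q := by
      cases n with
      | zero =>
        have := hB.neg_one_diff q
        simp only [Nat.cast_zero, zero_sub, this, mul_pow]
        ring
      | succ m =>
        have := hB.2.1 m (q + 1)
        simp only [Nat.cast_succ, add_sub_cancel_right, this]
        ring
    push_cast at h1
    have h0 := two_mul_X_add_one_ne_zero
    refine sub_eq_zero.1 ((mul_eq_zero.1 (?_ : (2 * Polynomial.X + 1) * _ = 0)).resolve_left h0)
    linear_combination h1 - h2 + h3

/-- The coefficient of the forward difference just below the top degree. -/
lemma coeff_natDegree_sub_one_comp_X_add_one_sub {P : Polynomial ℝ} {d : ℕ}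
    (hd : P.natDegree = d + 1) :
    (P.comp (Polynomial.X + 1) - P).coeff d = (d + 1) * P.coeff (d + 1) := by
  have h1 : P.comp (Polynomial.X + 1) = Polynomial.taylor 1 P := by
    simp [Polynomial.taylor_apply]
  rw [h1, Polynomial.coeff_sub, Polynomial.taylor_coeff]
  have h2 : (Polynomial.hasseDeriv d P).natDegree < 2 := by
    have := Polynomial.natDegree_hasseDeriv_le P d
    omega
  rw [Polynomial.eval_eq_sum_range' h2]
  simp [Finset.sum_range_succ, Polynomial.hasseDeriv_coeff]
  rw [Nat.add_comm 1 d]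
  simp

lemma natDegree_comp_X_add_one_sub_le {P : Polynomial ℝ} {d : ℕ}
    (hd : P.natDegree = d + 1) :
    (P.comp (Polynomial.X + 1) - P).natDegree ≤ d := by
  have h1 : P.comp (Polynomial.X + 1) = Polynomial.taylor 1 P := by
    simp [Polynomial.taylor_apply]
  rw [Polynomial.natDegree_le_iff_coeff_eq_zero]
  intro m hm
  rw [h1]
  obtain h | h := (Nat.succ_le_of_lt hm).eq_or_lt
  · have h3 := Polynomial.coeff_taylor_natDegree (r := (1 : ℝ)) (f := P)
    rw [hd] at h3
    rw [← h]
    simp [h3, Polynomial.leadingCoeff, hd]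
  · rw [Polynomial.coeff_eq_zero_of_natDegree_lt]
    refine (Polynomial.natDegree_sub_le _ _).trans_lt ?_
    simp [hd]
    omega

lemma natDegree_neg_X_mul_X_add_one_pow (q : ℕ) :
    (-((-Polynomial.X) * (Polynomial.X + 1 : Polynomial ℝ)) ^ q).natDegree = 2 * q ∧
    (-((-Polynomial.X) * (Polynomial.X + 1 : Polynomial ℝ)) ^ q).coeff (2 * q)
      = (-1) ^ (q + 1) := by
  have h1 : (Polynomial.X + 1 : Polynomial ℝ) = Polynomial.X + Polynomial.C 1 := by simp
  have h2 : (-((-Polynomial.X) * (Polynomial.X + 1 : Polynomial ℝ)) ^ q).natDegree = 2 * q := by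
    rw [h1, Polynomial.natDegree_neg, Polynomial.natDegree_pow, Polynomial.natDegree_mul
      (by simp) (Polynomial.X_add_C_ne_zero _), Polynomial.natDegree_neg,
      Polynomial.natDegree_X, Polynomial.natDegree_X_add_C]
    ring
  refine ⟨h2, ?_⟩
  conv_lhs => rw [← h2]
  rw [← Polynomial.leadingCoeff, Polynomial.leadingCoeff_neg, Polynomial.leadingCoeff_pow,
    Polynomial.leadingCoeff_mul, Polynomial.leadingCoeff_neg, h1,
    Polynomial.leadingCoeff_X_add_C, Polynomial.leadingCoeff_X]
  ring

lemma BProp.natDegree_neg_one (hB : BProp B) (q : ℕ) :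
    (B (-1) (q + 1)).natDegree = 2 * q + 1 ∧
    (2 * (q : ℝ) + 1) * (B (-1) (q + 1)).coeff (2 * q + 1) = (-1) ^ (q + 1) := by
  have hdiff := hB.neg_one_diff q
  have hodd := hB.1 (-1) (q + 1) le_rfl (by simp)
  obtain ⟨h1, h2⟩ := natDegree_neg_X_mul_X_add_one_pow q
  have hne : B (-1) (q + 1) ≠ 0 := by
    intro h
    rw [← hdiff, h] at h2
    simp at h2
    exact absurd h2.symm (pow_ne_zero _ (by norm_num))
  obtain ⟨d, hd⟩ : ∃ d, (B (-1) (q + 1)).natDegree = d + 1 := by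
    refine Nat.exists_eq_succ_of_ne_zero fun h => hne ?_
    obtain ⟨c, hc⟩ := Polynomial.natDegree_eq_zero.1 h
    rw [← hc] at hodd ⊢
    simp at hodd
    have := congrArg (Polynomial.eval 0) hodd
    simp at this
    simp [show c = 0 by linarith]
  have h3 := coeff_natDegree_sub_one_comp_X_add_one_sub hd
  have h4 := natDegree_comp_X_add_one_sub_le hd
  rw [hdiff] at h3 h4
  have h5 : d = 2 * q := by
    refine le_antisymm ?_ (h1 ▸ h4)
    rw [← h1]
    refine Polynomial.le_natDegree_of_ne_zero ?_
    rw [h3]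
    refine mul_ne_zero (by positivity) ?_
    rw [← hd]
    exact Polynomial.leadingCoeff_ne_zero.2 hne
  subst h5
  refine ⟨hd, ?_⟩
  rw [← h2, h3]
  push_cast
  ring

lemma BProp.coeff_even (hB : BProp B) (q k : ℕ) :
    (B (-1) (q + 1)).coeff (2 * k) = 0 := by
  have hodd := hB.1 (-1) (q + 1) le_rfl (by simp)
  rw [show (-Polynomial.X : Polynomial ℝ) = Polynomial.C (-1) * Polynomial.X by simp] at hodd
  have := congrArg (fun p => Polynomial.coeff p (2 * k)) hodd
  simp only [Polynomial.comp_C_mul_X_coeff, Polynomial.coeff_neg, pow_mul, neg_one_sq,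
    one_pow, mul_one] at this
  linarith

end Bernoulli

section SymmetricSums

lemma sum_esymVal_mul_pow {α R : Type*} [CommRing R] (s : Finset α) (f : α → R) (u : R) :
    ∑ n ∈ Finset.range (s.card + 1), (-1) ^ n * esymVal s f n * u ^ (s.card - n)
      = ∏ a ∈ s, (u - f a) := by
  classical
  have h : ∏ a ∈ s, (u - f a) = ∏ a ∈ s, (-f a + u) :=
    Finset.prod_congr rfl fun a _ => by ring
  rw [h, Finset.prod_add, Finset.sum_powerset]
  refine Finset.sum_congr rfl fun n _ => ?_
  rw [esymVal, Finset.mul_sum, Finset.sum_mul]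
  refine Finset.sum_congr rfl fun t ht => ?_
  obtain ⟨hts, rfl⟩ := Finset.mem_powersetCard.1 ht
  rw [Finset.prod_neg, Finset.prod_const, Finset.card_sdiff_of_subset hts]

lemma sum_powerset_sum_powerset_sdiff {α R : Type*} [DecidableEq α] [CommRing R] (s : Finset α)
    (x : α → R) (z y : R) :
    ∑ K1 ∈ s.powerset, ∑ K2 ∈ (s \ K1).powerset,
        (∏ a ∈ K1, x a) * (∏ a ∈ K2, x a) ^ 2 * (-z) ^ K1.card * y ^ (s.card - K1.card - K2.card)
      = ∏ a ∈ s, (y + (x a ^ 2 - z * x a)) := by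
  have h : ∏ a ∈ s, (y + (x a ^ 2 - z * x a)) = ∏ a ∈ s, (-z * x a + (x a ^ 2 + y)) :=
    Finset.prod_congr rfl fun a _ => by ring
  rw [h, Finset.prod_add]
  refine Finset.sum_congr rfl fun K1 hK1 => ?_
  rw [Finset.prod_add, Finset.mul_sum]
  refine Finset.sum_congr rfl fun K2 hK2 => ?_
  rw [Finset.mem_powerset] at hK1 hK2
  rw [Finset.prod_mul_distrib, Finset.prod_const, Finset.prod_const, Finset.prod_pow,
    Finset.card_sdiff_of_subset hK2, Finset.card_sdiff_of_subset hK1]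
  ring

end SymmetricSums

section Functional

variable {K : Type*} [Field K]

/-- The polynomial `H_n(Y)` with `(t₁ - t₂) H_n(t₁ t₂) = t₁ t₂ⁿ - t₂ t₁ⁿ` when `t₁ + t₂ = z`. -/
def lucasPoly (z : K) : ℕ → Polynomial K
  | 0 => 1
  | 1 => 0
  | n + 2 => Polynomial.C z * lucasPoly z (n + 1) - Polynomial.X * lucasPoly z n

lemma eval_lucasPoly (t₁ t₂ : K) (n : ℕ) :
    (t₁ - t₂) * (lucasPoly (t₁ + t₂) n).eval (t₁ * t₂) = t₁ * t₂ ^ n - t₂ * t₁ ^ n := by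
  induction n using Nat.twoStepInduction with
  | zero => simp [lucasPoly]
  | one => simp [lucasPoly]; ring
  | more n h1 h2 =>
    simp only [lucasPoly, Polynomial.eval_sub, Polynomial.eval_mul, Polynomial.eval_C,
      Polynomial.eval_X]
    linear_combination (t₁ + t₂) * h2 - t₁ * t₂ * h1

lemma two_mul_natDegree_lucasPoly_le (z : K) (n : ℕ) : 2 * (lucasPoly z n).natDegree ≤ n := by
  induction n using Nat.twoStepInduction with
  | zero => simp [lucasPoly]
  | one => simp [lucasPoly]
  | more n h1 h2 =>
    have h3 := Polynomial.natDegree_sub_le (Polynomial.C z * lucasPoly z (n + 1))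
      (Polynomial.X * lucasPoly z n)
    have h4 := Polynomial.natDegree_C_mul_le z (lucasPoly z (n + 1))
    have h5 := Polynomial.natDegree_mul_le (p := Polynomial.X) (q := lucasPoly z n)
    have h6 := Polynomial.natDegree_X_le (R := K)
    rw [lucasPoly]
    omega

/-- The linear functional on `K[Y]` sending `Y ^ q` to `b q`. -/
def umbral (b : ℕ → K) : Polynomial K →ₗ[K] K :=
  Polynomial.lsum fun q => LinearMap.toSpanSingleton K K (b q)

lemma umbral_X_pow (b : ℕ → K) (q : ℕ) : umbral b (Polynomial.X ^ q) = b q := by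
  simp [umbral, Polynomial.lsum_apply, ← Polynomial.monomial_one_right_eq_X_pow]

lemma umbral_C_mul (b : ℕ → K) (c : K) (P : Polynomial K) :
    umbral b (Polynomial.C c * P) = c * umbral b P := by
  rw [← Polynomial.smul_eq_C_mul, map_smul, smul_eq_mul]

lemma umbral_eq_sum (b : ℕ → K) {P : Polynomial K} {n : ℕ} (h : P.natDegree < n) :
    umbral b P = ∑ q : Fin n, b q * P.coeff q := by
  conv_lhs => rw [P.as_sum_range' n h]
  rw [map_sum, ← Finset.sum_range fun q => b q * P.coeff q]
  refine Finset.sum_congr rfl fun q _ => ?_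
  rw [← Polynomial.C_mul_X_pow_eq_monomial, umbral_C_mul, umbral_X_pow, mul_comm]

lemma umbral_X_pow_mul_lucasPoly (z : K) (b : ℕ → ℕ → K) (h1 : ∀ q, b 1 q = 0)
    (h2 : ∀ n q, b (n + 2) q = z * b (n + 1) q - b n (q + 1)) (n q : ℕ) :
    umbral (b 0) (Polynomial.X ^ q * lucasPoly z n) = b n q := by
  induction n using Nat.twoStepInduction generalizing q with
  | zero => simp [lucasPoly, umbral_X_pow]
  | one => simp [lucasPoly, h1]
  | more n ih1 ih2 =>
    rw [h2, ← ih1, ← ih2, lucasPoly, ← umbral_C_mul, ← map_sub]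
    congr 1
    ring

variable {α : Type*}

/-- The polynomial in `Y = t₁ t₂` representing
`(t₁ f(t₂) - t₂ f(t₁)) / (t₁ - t₂)` for `f(t) = ∏_{a ∈ s₁} (t - x_a) ∏_{a ∈ s₂} (t² - x_a²)`. -/
def pairPoly (x : α → K) (z : K) (s₁ s₂ : Finset α) : Polynomial K :=
  ∑ n₁ ∈ Finset.range (s₁.card + 1), ∑ n₂ ∈ Finset.range (s₂.card + 1),
    Polynomial.C ((-1) ^ (n₁ + n₂) * esymVal s₁ x n₁ * esymVal s₂ (fun a => x a ^ 2) n₂)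
      * lucasPoly z ((s₁.card - n₁) + 2 * (s₂.card - n₂))

lemma eval_pairPoly (x : α → K) (t₁ t₂ : K) (s₁ s₂ : Finset α) :
    (t₁ - t₂) * (pairPoly x (t₁ + t₂) s₁ s₂).eval (t₁ * t₂)
      = t₁ * ((∏ a ∈ s₁, (t₂ - x a)) * ∏ a ∈ s₂, (t₂ ^ 2 - x a ^ 2))
        - t₂ * ((∏ a ∈ s₁, (t₁ - x a)) * ∏ a ∈ s₂, (t₁ ^ 2 - x a ^ 2)) := by
  simp only [← sum_esymVal_mul_pow, Finset.sum_mul_sum]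
  simp only [Finset.mul_sum, pairPoly, Polynomial.eval_finsetSum, ← Finset.sum_sub_distrib]
  refine Finset.sum_congr rfl fun n₁ _ => Finset.sum_congr rfl fun n₂ _ => ?_
  rw [Polynomial.eval_mul, Polynomial.eval_C, mul_left_comm, eval_lucasPoly]
  ring

lemma natDegree_pairPoly_le (x : α → K) (z : K) (s₁ s₂ : Finset α) :
    (pairPoly x z s₁ s₂).natDegree ≤ (s₁.card + 2 * s₂.card) / 2 := by
  refine Polynomial.natDegree_sum_le_of_forall_le _ _ fun n₁ _ =>
    Polynomial.natDegree_sum_le_of_forall_le _ _ fun n₂ _ => ?_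
  refine (Polynomial.natDegree_C_mul_le _ _).trans ?_
  have := two_mul_natDegree_lucasPoly_le z ((s₁.card - n₁) + 2 * (s₂.card - n₂))
  omega

lemma umbral_X_pow_mul_pairPoly (x : α → K) (z : K) (s₁ s₂ : Finset α) (b : ℕ → ℕ → K)
    (h1 : ∀ q, b 1 q = 0) (h2 : ∀ n q, b (n + 2) q = z * b (n + 1) q - b n (q + 1)) (q : ℕ) :
    umbral (b 0) (Polynomial.X ^ q * pairPoly x z s₁ s₂)
      = ∑ n₁ ∈ Finset.range (s₁.card + 1), ∑ n₂ ∈ Finset.range (s₂.card + 1),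
          (-1) ^ (n₁ + n₂) * esymVal s₁ x n₁ * esymVal s₂ (fun a => x a ^ 2) n₂
            * b ((s₁.card - n₁) + 2 * (s₂.card - n₂)) q := by
  simp only [pairPoly, Finset.mul_sum, map_sum]
  refine Finset.sum_congr rfl fun n₁ _ => Finset.sum_congr rfl fun n₂ _ => ?_
  rw [mul_left_comm, umbral_C_mul, umbral_X_pow_mul_lucasPoly z b h1 h2]

/-- The product `∏_{a ∈ s} (Y + x_a² - z x_a)`. -/
def rootPoly (x : α → K) (z : K) (s : Finset α) : Polynomial K :=
  ∏ a ∈ s, (Polynomial.X + Polynomial.C (x a ^ 2 - z * x a))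

lemma natDegree_rootPoly (x : α → K) (z : K) (s : Finset α) :
    (rootPoly x z s).natDegree = s.card := by
  rw [rootPoly, Polynomial.natDegree_prod _ _ fun a _ => Polynomial.X_add_C_ne_zero _]
  simp only [Polynomial.natDegree_X_add_C, Finset.sum_const, smul_eq_mul, mul_one]

lemma umbral_rootPoly_mul [DecidableEq α] (x : α → K) (z : K) (s : Finset α) (b : ℕ → K)
    (P : Polynomial K) :
    umbral b (rootPoly x z s * P)
      = ∑ K1 ∈ s.powerset, ∑ K2 ∈ (s \ K1).powerset,
        (∏ a ∈ K1, x a) * (∏ a ∈ K2, x a) ^ 2 * (-z) ^ K1.card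
          * umbral b (Polynomial.X ^ (s.card - K1.card - K2.card) * P) := by
  have h : rootPoly x z s = ∏ a ∈ s, (Polynomial.X + (Polynomial.C (x a) ^ 2
      - Polynomial.C z * Polynomial.C (x a))) := by
    simp [rootPoly]
  rw [h, ← sum_powerset_sum_powerset_sdiff s (fun a => Polynomial.C (x a))]
  simp only [Finset.sum_mul, map_sum]
  refine Finset.sum_congr rfl fun K1 _ => Finset.sum_congr rfl fun K2 _ => ?_
  rw [← umbral_C_mul]
  congr 1
  simp only [map_mul, map_pow, map_neg, map_prod]
  ring

end Functional

section Determinant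

lemma prod_filter_lt_eq_prod_Ioi {M : Type*} [CommMonoid M] {ℓ : ℕ} (f : Fin ℓ → Fin ℓ → M) :
    ∏ p ∈ (univ : Finset (Fin ℓ × Fin ℓ)).filter (fun p => p.1 < p.2), f p.1 p.2
      = ∏ i, ∏ j ∈ Finset.Ioi i, f i j := by
  rw [Finset.prod_filter, ← Finset.univ_product_univ, Finset.prod_product]
  refine Finset.prod_congr rfl fun i _ => ?_
  rw [← Finset.prod_filter]
  refine Finset.prod_congr ?_ fun _ _ => rfl
  ext j
  simp

lemma prod_filter_lt_eq_prod_Iio {M : Type*} [CommMonoid M] {ℓ : ℕ} (f : Fin ℓ → Fin ℓ → M) :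
    ∏ p ∈ (univ : Finset (Fin ℓ × Fin ℓ)).filter (fun p => p.1 < p.2), f p.1 p.2
      = ∏ j, ∏ i ∈ Finset.Iio j, f i j := by
  rw [Finset.prod_filter, ← Finset.univ_product_univ, Finset.prod_product_right]
  refine Finset.prod_congr rfl fun i _ => ?_
  rw [← Finset.prod_filter]
  refine Finset.prod_congr ?_ fun _ _ => rfl
  ext j
  simp

lemma Jset_eq_Iio (ℓ : ℕ) (j : Fin ℓ) : Jset ℓ j = Finset.Iio j := by
  ext; simp [Jset]

variable {K : Type*} [Field K] {ℓ : ℕ}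

/-- The polynomial in `Y` whose umbral image is the one-variable function underlying `φ_j`. -/
def phiPoly (x : Fin ℓ → K) (z : K) (j : Fin ℓ) : Polynomial K :=
  if h : (j : ℕ) + 1 < ℓ then
    Polynomial.C (x j - x ⟨(j : ℕ) + 1, h⟩ - z) * (rootPoly x z (Jset ℓ j) *
      pairPoly x z {j, ⟨(j : ℕ) + 1, h⟩} (univ.filter fun a : Fin ℓ => (j : ℕ) + 1 < (a : ℕ)))
  else Polynomial.C (-x j) * rootPoly x z (Jset ℓ j)

lemma card_filter_succ_lt (j : Fin ℓ) (h : (j : ℕ) + 1 < ℓ) :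
    (univ.filter fun a : Fin ℓ => (j : ℕ) + 1 < (a : ℕ)).card = ℓ - j - 2 := by
  have : (univ.filter fun a : Fin ℓ => (j : ℕ) + 1 < (a : ℕ))
      = Finset.Ioi (⟨(j : ℕ) + 1, h⟩ : Fin ℓ) := by
    ext a; simp [Fin.lt_def]
  rw [this, Fin.card_Ioi]
  simp
  omega

lemma ne_succ_fin (j : Fin ℓ) (h : (j : ℕ) + 1 < ℓ) : j ≠ ⟨(j : ℕ) + 1, h⟩ := by
  simp [Fin.ext_iff]

lemma natDegree_phiPoly_lt (x : Fin ℓ → K) (z : K) (j : Fin ℓ) :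
    (phiPoly x z j).natDegree < ℓ := by
  unfold phiPoly
  have hJ := natDegree_rootPoly x z (Jset ℓ j)
  rw [Jset_eq_Iio, Fin.card_Iio] at hJ
  rw [Jset_eq_Iio]
  split_ifs with h
  · refine (Polynomial.natDegree_C_mul_le _ _).trans_lt ?_
    refine Polynomial.natDegree_mul_le.trans_lt ?_
    have h2 := natDegree_pairPoly_le x z {j, ⟨(j : ℕ) + 1, h⟩}
      (univ.filter fun a : Fin ℓ => (j : ℕ) + 1 < (a : ℕ))
    rw [card_filter_succ_lt j h, Finset.card_pair (ne_succ_fin j h)] at h2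
    omega
  · refine (Polynomial.natDegree_C_mul_le _ _).trans_lt ?_
    omega

lemma eval_rootPoly (x : Fin ℓ → K) (z : K) (s : Finset (Fin ℓ)) (y : K) :
    (rootPoly x z s).eval y = ∏ a ∈ s, (y - x a * (z - x a)) := by
  rw [rootPoly, Polynomial.eval_prod]
  refine Finset.prod_congr rfl fun a _ => ?_
  simp only [Polynomial.eval_add, Polynomial.eval_X, Polynomial.eval_C]
  ring

lemma eval_phiPoly_of_lt (x : Fin ℓ → K) (z : K) {s j : Fin ℓ} (h : s < j) :
    (phiPoly x z j).eval (x s * (z - x s)) = 0 := by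
  have h0 : (rootPoly x z (Jset ℓ j)).eval (x s * (z - x s)) = 0 := by
    rw [eval_rootPoly]
    exact Finset.prod_eq_zero (i := s) (by simpa [Jset] using h) (sub_self _)
  unfold phiPoly
  split_ifs <;> simp [h0]

lemma eval_phiPoly_self (x : Fin ℓ → K) (z : K) (j : Fin ℓ) (hz : 2 * x j ≠ z) :
    (phiPoly x z j).eval (x j * (z - x j))
      = (if (j : ℕ) + 1 < ℓ then 1 else -1) * x j
        * (∏ a ∈ Finset.Iio j, (x j * (z - x j) - x a * (z - x a)))
        * ∏ a ∈ Finset.Ioi j, ((x j + x a - z) * (x j - x a - z)) := by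
  unfold phiPoly
  split_ifs with h
  · have hpair := eval_pairPoly x (x j) (z - x j) {j, ⟨(j : ℕ) + 1, h⟩}
      (univ.filter fun a : Fin ℓ => (j : ℕ) + 1 < (a : ℕ))
    rw [Finset.prod_pair (ne_succ_fin j h), Finset.prod_pair (ne_succ_fin j h)] at hpair
    have hIoi : Finset.Ioi j = insert ⟨(j : ℕ) + 1, h⟩
        (univ.filter fun a : Fin ℓ => (j : ℕ) + 1 < (a : ℕ)) := by
      ext a
      simp only [Finset.mem_Ioi, Finset.mem_insert, Finset.mem_filter, Finset.mem_univ,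
        true_and, Fin.ext_iff, Fin.lt_def]
      omega
    rw [hIoi, Finset.prod_insert (by simp)]
    have hprod : ∏ a ∈ univ.filter (fun a : Fin ℓ => (j : ℕ) + 1 < (a : ℕ)),
          ((x j + x a - z) * (x j - x a - z))
        = ∏ a ∈ univ.filter (fun a : Fin ℓ => (j : ℕ) + 1 < (a : ℕ)),
          ((z - x j) ^ 2 - x a ^ 2) :=
      Finset.prod_congr rfl fun a _ => by ring
    rw [hprod]
    have hne : x j - (z - x j) ≠ 0 := by
      intro h0
      exact hz (by linear_combination h0)
    simp only [add_sub_cancel, sub_self, zero_mul, mul_zero, sub_zero] at hpair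
    simp only [Polynomial.eval_mul, Polynomial.eval_C, eval_rootPoly, Jset_eq_Iio]
    refine mul_left_cancel₀ hne ?_
    linear_combination (x j - x ⟨(j : ℕ) + 1, h⟩ - z)
      * (∏ a ∈ Finset.Iio j, (x j * (z - x j) - x a * (z - x a))) * hpair
  · have hIoi : Finset.Ioi j = ∅ := by
      ext a
      simp only [Finset.mem_Ioi, Finset.notMem_empty, Fin.lt_def, iff_false]
      omega
    simp only [hIoi, Polynomial.eval_mul, Polynomial.eval_C, eval_rootPoly, Jset_eq_Iio,
      Finset.prod_empty]
    ring

lemma prod_ite_succ_lt (hℓ : 1 ≤ ℓ) :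
    ∏ j : Fin ℓ, (if (j : ℕ) + 1 < ℓ then (1 : K) else -1) = -1 := by
  obtain ⟨m, rfl⟩ : ∃ m, ℓ = m + 1 := ⟨ℓ - 1, by omega⟩
  rw [Fin.prod_univ_castSucc]
  simp

lemma det_coeff_phiPoly (hℓ : 1 ≤ ℓ) (x : Fin ℓ → K) (z : K) (hz : ∀ j, 2 * x j ≠ z)
    (hne : ∀ i j, i < j → x j * (z - x j) - x i * (z - x i) ≠ 0) :
    Matrix.det (Matrix.of fun q j : Fin ℓ => (phiPoly x z j).coeff q)
      = -((∏ j, x j) *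
        ∏ p ∈ (univ : Finset (Fin ℓ × Fin ℓ)).filter (fun p => p.1 < p.2),
          ((x p.1 + x p.2 - z) * (x p.1 - x p.2 - z))) := by
  set V : Matrix (Fin ℓ) (Fin ℓ) K := Matrix.vandermonde fun s => x s * (z - x s) with hV
  set D : Matrix (Fin ℓ) (Fin ℓ) K := Matrix.of fun q j : Fin ℓ => (phiPoly x z j).coeff q
    with hD
  have hVdet : V.det = ∏ p ∈ (univ : Finset (Fin ℓ × Fin ℓ)).filter (fun p => p.1 < p.2),
      (x p.2 * (z - x p.2) - x p.1 * (z - x p.1)) := by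
    rw [hV, Matrix.det_vandermonde,
      prod_filter_lt_eq_prod_Ioi fun i j => x j * (z - x j) - x i * (z - x i)]
  have hV0 : V.det ≠ 0 := by
    rw [hVdet]
    refine Finset.prod_ne_zero_iff.2 fun p hp => hne _ _ ?_
    simpa using hp
  have hVD : V * D = Matrix.of fun s j => (phiPoly x z j).eval (x s * (z - x s)) := by
    ext s j
    rw [Matrix.mul_apply, Matrix.of_apply,
      Polynomial.eval_eq_sum_range' (natDegree_phiPoly_lt x z j), Finset.sum_range]
    exact Finset.sum_congr rfl fun q _ => mul_comm _ _
  have hdet : V.det * D.det = ∏ j, (phiPoly x z j).eval (x j * (z - x j)) := by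
    rw [← Matrix.det_mul, hVD, Matrix.det_of_isLowerTriangular]
    · rfl
    · intro s j hsj
      exact eval_phiPoly_of_lt x z hsj
  refine mul_left_cancel₀ hV0 ?_
  rw [hdet, hVdet, prod_filter_lt_eq_prod_Iio fun i j => x j * (z - x j) - x i * (z - x i),
    prod_filter_lt_eq_prod_Ioi fun i j => (x i + x j - z) * (x i - x j - z),
    Finset.prod_congr rfl fun j _ => eval_phiPoly_self x z j (hz j), Finset.prod_mul_distrib,
    Finset.prod_mul_distrib, Finset.prod_mul_distrib, prod_ite_succ_lt hℓ]
  ring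

/-- Coefficients of the homogenization of `x · B_{-1,q}` in powers of `x²`. -/
def bernCoeff (B : ℤ → ℕ → Polynomial ℝ) (c : ℝ →+* K) (z : K) : ℕ → ℕ → K
  | 0, 0 => -1
  | _ + 1, 0 => 0
  | 0, _ + 1 => 0
  | k + 1, q + 1 => c ((B (-1) (q + 1)).coeff (2 * k + 1)) * z ^ (2 * q - 2 * k)

variable {B : ℤ → ℕ → Polynomial ℝ}

lemma sum_range_two_mul {M : Type*} [AddCommMonoid M] (f : ℕ → M) (n : ℕ) :
    ∑ m ∈ Finset.range (2 * n), f m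
      = ∑ k ∈ Finset.range n, (f (2 * k) + f (2 * k + 1)) := by
  induction n with
  | zero => simp
  | succ n ih =>
    rw [show 2 * (n + 1) = 2 * n + 1 + 1 by ring, Finset.sum_range_succ, Finset.sum_range_succ,
      Finset.sum_range_succ, ih, add_assoc]

lemma bernCoeff_eq_zero (hB : BProp B) (c : ℝ →+* K) (z : K) {k q : ℕ} (h : q < k) :
    bernCoeff B c z k q = 0 := by
  match k, q, h with
  | k + 1, 0, _ => rfl
  | k + 1, q + 1, h =>
    rw [bernCoeff, Polynomial.coeff_eq_zero_of_natDegree_lt, map_zero, zero_mul]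
    rw [(hB.natDegree_neg_one q).1]
    omega

lemma homogenize_neg_one_eq_sum (hB : BProp B) (c : ℝ →+* K) {x z : K} (hx : x ≠ 0)
    (hz : z ≠ 0) (q : ℕ) :
    z ^ (2 * q + 1) * Polynomial.eval₂ c (x / z) (B (-1) (q + 1))
      = x⁻¹ * ∑ k ∈ Finset.range (q + 2), (x ^ 2) ^ k * bernCoeff B c z k (q + 1) := by
  have hdeg : (B (-1) (q + 1)).natDegree < 2 * (q + 1) := by
    rw [(hB.natDegree_neg_one q).1]; omega
  rw [Polynomial.eval₂_eq_sum_range' _ hdeg, sum_range_two_mul,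
    Finset.sum_range_succ' (fun k => (x ^ 2) ^ k * bernCoeff B c z k (q + 1)),
    show bernCoeff B c z 0 (q + 1) = 0 from rfl, mul_zero, add_zero, Finset.mul_sum,
    Finset.mul_sum]
  refine Finset.sum_congr rfl fun k hk => ?_
  rw [bernCoeff, hB.coeff_even, map_zero, zero_mul, zero_add]
  obtain ⟨r, rfl⟩ : ∃ r, q = k + r := ⟨q - k, by have := Finset.mem_range.1 hk; omega⟩
  rw [show 2 * (k + r) - 2 * k = 2 * r by omega]
  rw [div_pow, show 2 * (k + r) + 1 = 2 * r + (2 * k + 1) by ring, pow_add]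
  field_simp
  ring

lemma prod_neg_one_pow_mul_bernCoeff (hB : BProp B) (c : ℝ →+* K) (z : K) (hℓ : 1 ≤ ℓ) :
    ∏ q : Fin ℓ, ((-1) ^ (q : ℕ) * bernCoeff B c z q q)
      = -c (∏ m ∈ Finset.range (ℓ - 1), (2 * (m : ℝ) + 1))⁻¹ := by
  obtain ⟨m, rfl⟩ : ∃ m, ℓ = m + 1 := ⟨ℓ - 1, by omega⟩
  rw [← Finset.prod_range fun q => (-1) ^ q * bernCoeff B c z q q, Finset.prod_range_succ',
    Nat.add_sub_cancel, ← Finset.prod_inv_distrib, map_prod]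
  have h : ∀ q ∈ Finset.range m, (-1) ^ (q + 1) * bernCoeff B c z (q + 1) (q + 1)
      = c (2 * (q : ℝ) + 1)⁻¹ := by
    intro q _
    have hq := (hB.natDegree_neg_one q).2
    have hpos : (2 * (q : ℝ) + 1) ≠ 0 := by positivity
    rw [bernCoeff, Nat.sub_self, pow_zero, mul_one,
      show ((-1 : K)) ^ (q + 1) = c ((-1) ^ (q + 1)) by simp, ← map_mul]
    congr 1
    rw [← mul_eq_one_iff_eq_inv₀ hpos]
    have h1 : ((-1 : ℝ) ^ (q + 1)) * (-1) ^ (q + 1) = 1 := by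
      rw [← mul_pow]; simp
    linear_combination (-1) ^ (q + 1) * hq + h1
  rw [Finset.prod_congr rfl h]
  simp [bernCoeff]

end Determinant

section Main

variable {B : ℤ → ℕ → Polynomial ℝ} {ℓ : ℕ}

lemma zz_ne_zero (ℓ : ℕ) : zz ℓ ≠ 0 := by
  rw [zz, Ne, FaithfulSMul.algebraMap_eq_zero_iff]
  exact X_ne_zero _

lemma xx_ne_zero (i : Fin ℓ) : xx ℓ i ≠ 0 := by
  rw [xx, Ne, FaithfulSMul.algebraMap_eq_zero_iff]
  exact X_ne_zero _

lemma algebraMap_ne_zero_of_eval {p : SS ℓ} (v : Fin (ℓ + 1) → ℝ) (h : eval v p ≠ 0) :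
    algebraMap (SS ℓ) (KK ℓ) p ≠ 0 := by
  rw [Ne, FaithfulSMul.algebraMap_eq_zero_iff]
  rintro rfl
  simp at h

lemma two_mul_xx_ne_zz (i : Fin ℓ) : 2 * xx ℓ i ≠ zz ℓ := by
  have := algebraMap_ne_zero_of_eval (p := 2 * X i.castSucc - X (Fin.last ℓ))
    (fun a => if a = Fin.last ℓ then 1 else 0) (by simp [(Fin.castSucc_lt_last i).ne])
  rw [map_sub, map_mul, map_ofNat] at this
  exact sub_ne_zero.1 this

lemma root_sub_root_ne_zero {i j : Fin ℓ} (h : i < j) :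
    xx ℓ j * (zz ℓ - xx ℓ j) - xx ℓ i * (zz ℓ - xx ℓ i) ≠ 0 := by
  have := algebraMap_ne_zero_of_eval (ℓ := ℓ) (p := X j.castSucc * (X (Fin.last ℓ) - X j.castSucc)
      - X i.castSucc * (X (Fin.last ℓ) - X i.castSucc))
    (fun a => if a = i.castSucc then 1 else 0) (by
      simp [(Fin.castSucc_lt_last i).ne', h.ne'])
  rw [map_sub, map_mul, map_mul, map_sub, map_sub] at this
  exact this

lemma arB_zero (hB : BProp B) (q : ℕ) (x : KK ℓ) : arB B ℓ 0 q x = 0 := by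
  simp [arB, hB.zero_left]

lemma arB_recurrence (hB : BProp B) (n q : ℕ) (x : KK ℓ) :
    arB B ℓ ((n : ℤ) + 1) q x = zz ℓ * arB B ℓ n q x - arB B ℓ ((n : ℤ) - 1) (q + 1) x := by
  have hz := zz_ne_zero ℓ
  rw [arB, arB, arB, if_neg (by omega), if_neg (by omega), if_neg (by omega), hB.recurrence,
    Polynomial.eval₂_sub, ← mul_assoc, ← zpow_one_add₀ hz,
    show (n : ℤ) - 1 + 2 * ((q + 1 : ℕ) : ℤ) = 1 + (n + 2 * (q : ℤ)) by push_cast; ring,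
    show (n : ℤ) + 1 + 2 * (q : ℤ) = 1 + (n + 2 * (q : ℤ)) by ring]
  ring

/-- `arB` with its first index shifted by one. -/
def shiftedArB (B : ℤ → ℕ → Polynomial ℝ) (ℓ : ℕ) (x : KK ℓ) (n q : ℕ) : KK ℓ :=
  arB B ℓ ((n : ℤ) - 1) q x

lemma shiftedArB_one (hB : BProp B) (x : KK ℓ) (q : ℕ) : shiftedArB B ℓ x 1 q = 0 := by
  simp [shiftedArB, arB_zero hB]

lemma shiftedArB_add_two (hB : BProp B) (x : KK ℓ) (n q : ℕ) :
    shiftedArB B ℓ x (n + 2) q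
      = zz ℓ * shiftedArB B ℓ x (n + 1) q - shiftedArB B ℓ x n (q + 1) := by
  have h := arB_recurrence hB n q x
  simp only [shiftedArB]
  rw [← show (n : ℤ) + 1 = ((n + 2 : ℕ) : ℤ) - 1 by push_cast; ring,
    ← show (n : ℤ) = ((n + 1 : ℕ) : ℤ) - 1 by push_cast; ring, h]

lemma phi_eq_umbral (hB : BProp B) (j i : Fin ℓ) :
    phi B ℓ j i = umbral (shiftedArB B ℓ (xx ℓ i) 0) (phiPoly (xx ℓ) (zz ℓ) j) := by
  have hJ : (Jset ℓ j).card = j := by rw [Jset_eq_Iio, Fin.card_Iio]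
  unfold phi phiPoly
  split_ifs with h
  · rw [umbral_C_mul, umbral_rootPoly_mul, hJ]
    refine congrArg₂ _ rfl ?_
    refine Finset.sum_congr rfl fun K1 _ => Finset.sum_congr rfl fun K2 _ => ?_
    rw [umbral_X_pow_mul_pairPoly _ _ _ _ _ (shiftedArB_one hB _) (shiftedArB_add_two hB _),
      Finset.card_pair (ne_succ_fin j h), card_filter_succ_lt j h,
      show ℓ - (j : ℕ) - 2 + 1 = ℓ - j - 1 by omega]
    refine congrArg₂ _ rfl ?_
    refine Finset.sum_congr rfl fun n₁ h₁ => Finset.sum_congr rfl fun n₂ h₂ => ?_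
    rw [shiftedArB]
    rw [Finset.mem_range] at h₁ h₂
    refine congrArg₂ _ rfl (congrArg (fun p => arB B ℓ p _ _) ?_)
    omega
  · rw [umbral_C_mul, ← mul_one (rootPoly _ _ _), umbral_rootPoly_mul, hJ, Finset.mul_sum]
    refine Finset.sum_congr rfl fun K1 _ => ?_
    rw [Finset.mul_sum]
    refine Finset.sum_congr rfl fun K2 _ => ?_
    rw [mul_one, umbral_X_pow, shiftedArB, Nat.cast_zero, zero_sub]
    ring

lemma shiftedArB_zero_eq_sum (hB : BProp B) (i q : Fin ℓ) :
    shiftedArB B ℓ (xx ℓ i) 0 q = (xx ℓ i)⁻¹ * ∑ k : Fin ℓ, (xx ℓ i ^ 2) ^ (k : ℕ)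
      * bernCoeff B ((algebraMap (SS ℓ) (KK ℓ)).comp MvPolynomial.C) (zz ℓ) k q := by
  set c := (algebraMap (SS ℓ) (KK ℓ)).comp MvPolynomial.C with hc
  have hsum : ∑ k : Fin ℓ, (xx ℓ i ^ 2) ^ (k : ℕ) * bernCoeff B c (zz ℓ) k q
      = ∑ k ∈ Finset.range ((q : ℕ) + 1), (xx ℓ i ^ 2) ^ k * bernCoeff B c (zz ℓ) k q := by
    rw [← Finset.sum_range fun k => (xx ℓ i ^ 2) ^ k * bernCoeff B c (zz ℓ) k q]
    symm
    refine Finset.sum_subset (Finset.range_subset_range.2 q.2) fun k _ hk => ?_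
    rw [bernCoeff_eq_zero hB c _ (by simpa using hk), mul_zero]
  rw [hsum]
  obtain ⟨q, hq⟩ := q
  cases q with
  | zero => simp [shiftedArB, arB, bernCoeff]
  | succ q =>
    rw [← homogenize_neg_one_eq_sum hB c (xx_ne_zero i) (zz_ne_zero ℓ), shiftedArB, arB,
      if_neg (by simp), Nat.cast_zero, zero_sub,
      show (-1 : ℤ) + 2 * ((q + 1 : ℕ) : ℤ) = ((2 * q + 1 : ℕ) : ℤ) by push_cast; ring,
      zpow_natCast]

lemma det_shiftedArB (hB : BProp B) (hℓ : 1 ≤ ℓ) :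
    (∏ i, xx ℓ i) * Matrix.det (Matrix.of fun i q : Fin ℓ => shiftedArB B ℓ (xx ℓ i) 0 q)
      = -(algebraMap (SS ℓ) (KK ℓ) (C (∏ m ∈ Finset.range (ℓ - 1), (2 * (m : ℝ) + 1))⁻¹)) *
        ∏ p ∈ (univ : Finset (Fin ℓ × Fin ℓ)).filter (fun p => p.1 < p.2),
          (xx ℓ p.1 ^ 2 - xx ℓ p.2 ^ 2) := by
  set c := (algebraMap (SS ℓ) (KK ℓ)).comp MvPolynomial.C with hc
  set U : Matrix (Fin ℓ) (Fin ℓ) (KK ℓ) :=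
    Matrix.of fun k q : Fin ℓ => bernCoeff B c (zz ℓ) k q with hU
  have hUdet : U.det = ∏ q : Fin ℓ, bernCoeff B c (zz ℓ) q q := by
    rw [Matrix.det_of_isUpperTriangular]
    · rfl
    · intro k q hkq
      exact bernCoeff_eq_zero hB c _ hkq
  have hfac : (Matrix.of fun i q : Fin ℓ => shiftedArB B ℓ (xx ℓ i) 0 q)
      = Matrix.diagonal (fun i => (xx ℓ i)⁻¹) *
        (Matrix.vandermonde (fun i => xx ℓ i ^ 2) * U) := by
    ext i q
    rw [Matrix.diagonal_mul, Matrix.mul_apply, Matrix.of_apply, shiftedArB_zero_eq_sum hB]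
    rfl
  have hX : (∏ i, xx ℓ i) * ∏ i, (xx ℓ i)⁻¹ = 1 := by
    rw [← Finset.prod_mul_distrib]
    exact Finset.prod_eq_one fun i _ => mul_inv_cancel₀ (xx_ne_zero i)
  have hsign : ∏ p ∈ (univ : Finset (Fin ℓ × Fin ℓ)).filter (fun p => p.1 < p.2),
        (xx ℓ p.2 ^ 2 - xx ℓ p.1 ^ 2)
      = (∏ q : Fin ℓ, (-1) ^ (q : ℕ)) *
        ∏ p ∈ (univ : Finset (Fin ℓ × Fin ℓ)).filter (fun p => p.1 < p.2),
          (xx ℓ p.1 ^ 2 - xx ℓ p.2 ^ 2) := by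
    rw [prod_filter_lt_eq_prod_Iio fun i j => xx ℓ j ^ 2 - xx ℓ i ^ 2,
      prod_filter_lt_eq_prod_Iio fun i j => xx ℓ i ^ 2 - xx ℓ j ^ 2, ← Finset.prod_mul_distrib]
    refine Finset.prod_congr rfl fun j _ => ?_
    rw [← Fin.card_Iio j, ← Finset.prod_const, ← Finset.prod_mul_distrib]
    exact Finset.prod_congr rfl fun i _ => by ring
  have hconst := prod_neg_one_pow_mul_bernCoeff hB c (zz ℓ) hℓ
  rw [Finset.prod_mul_distrib, ← hUdet] at hconst
  change _ = -c _ * _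
  rw [hfac, Matrix.det_mul, Matrix.det_mul, Matrix.det_diagonal, Matrix.det_vandermonde,
    ← prod_filter_lt_eq_prod_Ioi fun i j => xx ℓ j ^ 2 - xx ℓ i ^ 2, hsign, ← hconst,
    ← mul_assoc, hX]
  ring

end Main

/-- Let `ℓ ≥ 2`.  Then
`det[(φ_j(x_i))_{1≤i,j≤ℓ}]
  = (1/(2ℓ−3)!!) · ∏_{1≤s<t≤ℓ} ∏_{ε∈{−1,1}} (x_s + εx_t − z)(x_s + εx_t)`,
where `(2ℓ−3)!! = ∏_{m=1}^{ℓ−1}(2m−1)`. -/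
theorem det_phi_eq (B : ℤ → ℕ → Polynomial ℝ) (hB : BProp B)
    (ℓ : ℕ) (hℓ : 2 ≤ ℓ) :
    Matrix.det (Matrix.of fun i j : Fin ℓ => phi B ℓ j i)
      = algebraMap (SS ℓ) (KK ℓ)
          (C (∏ m ∈ Finset.range (ℓ - 1), (2 * (m : ℝ) + 1))⁻¹ *
            ∏ p ∈ (univ : Finset (Fin ℓ × Fin ℓ)).filter (fun p => p.1 < p.2),
              ((X p.1.castSucc + X p.2.castSucc - X (Fin.last ℓ))
                * (X p.1.castSucc + X p.2.castSucc)
                * ((X p.1.castSucc - X p.2.castSucc - X (Fin.last ℓ))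
                    * (X p.1.castSucc - X p.2.castSucc)))) := by
  have hfac : (Matrix.of fun i j : Fin ℓ => phi B ℓ j i)
      = (Matrix.of fun i q : Fin ℓ => shiftedArB B ℓ (xx ℓ i) 0 q) *
        Matrix.of fun q j : Fin ℓ => (phiPoly (xx ℓ) (zz ℓ) j).coeff q := by
    ext i j
    rw [Matrix.of_apply, Matrix.mul_apply, phi_eq_umbral hB,
      umbral_eq_sum _ (natDegree_phiPoly_lt (xx ℓ) (zz ℓ) j)]
    rfl
  have hA := det_shiftedArB (ℓ := ℓ) hB (by omega)
  have hD := det_coeff_phiPoly (by omega) (xx ℓ) (zz ℓ) two_mul_xx_ne_zz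
    fun _ _ => root_sub_root_ne_zero
  rw [hfac, Matrix.det_mul, hD, map_mul, map_prod]
  have hprod : ∏ p ∈ (univ : Finset (Fin ℓ × Fin ℓ)).filter (fun p => p.1 < p.2),
        algebraMap (SS ℓ) (KK ℓ) ((X p.1.castSucc + X p.2.castSucc - X (Fin.last ℓ))
          * (X p.1.castSucc + X p.2.castSucc)
          * ((X p.1.castSucc - X p.2.castSucc - X (Fin.last ℓ))
            * (X p.1.castSucc - X p.2.castSucc)))
      = (∏ p ∈ (univ : Finset (Fin ℓ × Fin ℓ)).filter (fun p => p.1 < p.2),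
          (xx ℓ p.1 ^ 2 - xx ℓ p.2 ^ 2)) *
        ∏ p ∈ (univ : Finset (Fin ℓ × Fin ℓ)).filter (fun p => p.1 < p.2),
          ((xx ℓ p.1 + xx ℓ p.2 - zz ℓ) * (xx ℓ p.1 - xx ℓ p.2 - zz ℓ)) := by
    rw [← Finset.prod_mul_distrib]
    refine Finset.prod_congr rfl fun p _ => ?_
    simp only [map_mul, map_sub, map_add, xx, zz]
    ring
  rw [hprod]
  linear_combination (-∏ p ∈ (univ : Finset (Fin ℓ × Fin ℓ)).filter (fun p => p.1 < p.2),
    ((xx ℓ p.1 + xx ℓ p.2 - zz ℓ) * (xx ℓ p.1 - xx ℓ p.2 - zz ℓ))) * hA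

end
end
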